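/- For all integers m, n and every positive integer c, the Kloosterman sum satisfies the Weil bound |S(m, n, c)| ≤ τ(c) · gcd(m, n, c)^{1/2} · c^{1/2}. -/

import Mathlib

open scoped Real

/-- The Kloosterman sum `S(m, n, c) = ∑_{d mod c, (d,c)=1} e((m d + n d̄)/c)`,
where `d̄` is the multiplicative inverse of `d` modulo `c`. -/
noncomputable def kloostermanSum (m n : ℤ) (c : ℕ) : ℂ :=
  ∑ d ∈ (Finset.range c).filter (fun d => Nat.gcd d c = 1),
    Complex.exp (2 * π * Complex.I *
      (((m * (d : ℤ) + n * ((((d : ZMod c)⁻¹ : ZMod c)).val : ℤ) : ℤ) : ℂ) / (c : ℂ)))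

section Stepanov
open Polynomial

variable {F : Type*} [Field F]

theorem eq_zero_of_sum_X_pow_mul_eq_zero {r J : ℕ} (G : ℕ → F[X])
    (hG : ∀ i < J, X ^ r ∣ G i → G i = 0)
    (hsum : ∑ i ∈ Finset.range J, X ^ (r * i) * G i = 0) : ∀ i < J, G i = 0 := by
  induction J generalizing G with
  | zero => intro i hi; omega
  | succ J ih =>
    rw [Finset.sum_range_succ'] at hsum
    have hfac : ∑ i ∈ Finset.range J, X ^ (r * (i + 1)) * G (i + 1)
        = X ^ r * ∑ i ∈ Finset.range J, X ^ (r * i) * G (i + 1) := by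
      rw [Finset.mul_sum]
      refine Finset.sum_congr rfl fun i _ => ?_
      ring
    rw [hfac] at hsum
    have h0 : G 0 = 0 := by
      apply hG 0 (by omega)
      refine ⟨-∑ i ∈ Finset.range J, X ^ (r * i) * G (i + 1), ?_⟩
      simp only [mul_zero, pow_zero, one_mul] at hsum
      linear_combination hsum
    rw [h0, mul_zero, add_zero] at hsum
    have := ih (fun i => G (i + 1)) (fun i hi => hG (i + 1) (by omega))
      ((mul_eq_zero.mp hsum).resolve_left (pow_ne_zero _ X_ne_zero))
    intro i hi
    rcases i with _ | i
    · exact h0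
    · exact this i (by omega)

theorem eq_zero_of_X_pow_dvd_add_mul_pow {p m d : ℕ} [Fact p.Prime] [CharP F p] (hp : p ≠ 2)
    {D : F[X]} (hdeg : D.natDegree ≤ 2 * d) (hD0 : D.eval 0 ≠ 0)
    (hD : ∀ A E : F[X], ∀ c : F, c ≠ 0 → A ^ 2 = C c * D * E ^ 2 → E = 0)
    {A E : F[X]} (hA : 2 * A.natDegree < p ^ m) (hE : 2 * E.natDegree + 2 * d < p ^ m)
    (h : X ^ (p ^ m) ∣ A + E * D ^ ((p ^ m + 1) / 2)) : A = 0 ∧ E = 0 := by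
  have hodd : Odd (p ^ m) := ((Fact.out : p.Prime).odd_of_ne_two hp).pow
  have hr : (p ^ m + 1) / 2 * 2 = p ^ m + 1 := by
    obtain ⟨k, hk⟩ := hodd
    omega
  set W := D ^ ((p ^ m + 1) / 2) with hW
  have hW2 : W ^ 2 = D ^ (p ^ m) * D := by rw [hW, ← pow_mul, hr, pow_succ]
  have h1 : X ^ (p ^ m) ∣ D ^ (p ^ m) - C (D.eval 0 ^ (p ^ m)) := by
    rw [C_pow, ← sub_pow_char_pow (p := p)]
    apply pow_dvd_pow_of_dvd
    rw [X_dvd_iff]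
    simp [coeff_zero_eq_eval_zero]
  have h2 : X ^ (p ^ m) ∣ A ^ 2 - C (D.eval 0 ^ (p ^ m)) * D * E ^ 2 := by
    have e : A ^ 2 - C (D.eval 0 ^ (p ^ m)) * D * E ^ 2
      = (A + E * W) * (A - E * W) + (D ^ (p ^ m) - C (D.eval 0 ^ (p ^ m))) * (D * E ^ 2) := by
      linear_combination E ^ 2 * hW2
    rw [e]
    exact dvd_add (h.mul_right _) (h1.mul_right _)
  have h3 : A ^ 2 - C (D.eval 0 ^ (p ^ m)) * D * E ^ 2 = 0 := by
    by_contra hne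
    have hle := natDegree_le_of_dvd h2 hne
    rw [natDegree_X_pow] at hle
    have := natDegree_sub_le (A ^ 2) (C (D.eval 0 ^ (p ^ m)) * D * E ^ 2)
    have ha : (A ^ 2).natDegree ≤ 2 * A.natDegree := natDegree_pow_le
    have hb : (C (D.eval 0 ^ (p ^ m)) * D * E ^ 2).natDegree ≤ 2 * d + 2 * E.natDegree := by
      refine natDegree_mul_le.trans (add_le_add ?_ natDegree_pow_le)
      exact (natDegree_C_mul_le _ _).trans hdeg
    have := max_le (ha.trans hA.le) (hb.trans (by omega))
    rcases max_choice (A ^ 2).natDegree (C (D.eval 0 ^ (p ^ m)) * D * E ^ 2).natDegree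
      with h | h <;>
    omega
  have hE0 : E = 0 := hD A E _ (pow_ne_zero _ hD0) (sub_eq_zero.mp h3)
  refine ⟨?_, hE0⟩
  rw [hE0] at h3
  simpa using h3

/-- The coefficients, raised to the power `r`, of the auxiliary polynomial in Stepanov's method. -/
theorem exists_auxiliary_polynomials {r J a e M : ℕ} {W : F[X]}
    (hA : J + r * a ≤ M + r) (hE : J + r * e + W.natDegree ≤ M + r)
    (ha : 0 < a) (he : 0 < e)
    (hdim : M < J * (a + e)) :
    ∃ A E : Fin J → F[X], (∀ i, (A i).degree < a) ∧ (∀ i, (E i).degree < e) ∧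
      (∃ i, A i ≠ 0 ∨ E i ≠ 0) ∧
      ∑ i : Fin J, X ^ (i : ℕ) * (expand F r (A i) + expand F r (E i) * W) = 0 := by
  let V := Fin J → (degreeLT F a × degreeLT F e)
  let f : V →ₗ[F] F[X] := ∑ i : Fin J,
    (LinearMap.mulLeft F (X ^ (i : ℕ)) ∘ₗ
      ((expand F r).toLinearMap ∘ₗ (degreeLT F a).subtype ∘ₗ LinearMap.fst F _ _ +
       LinearMap.mulRight F W ∘ₗ (expand F r).toLinearMap ∘ₗ (degreeLT F e).subtype ∘ₗ
        LinearMap.snd F _ _)) ∘ₗ LinearMap.proj i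
  have hf : ∀ v : V, f v = ∑ i : Fin J, X ^ (i : ℕ) *
      (expand F r (v i).1 + expand F r (v i).2 * W) := by
    intro v
    simp only [f, LinearMap.sum_apply]
    exact Finset.sum_congr rfl fun i _ => by simp; rfl
  have hlt : ∀ {n : ℕ} (g : F[X]), g.degree < n → 0 < n → g.natDegree + 1 ≤ n := by
    intro n g hg hn
    by_cases h0 : g = 0
    · simp [h0]; omega
    · exact (natDegree_lt_iff_degree_lt h0).2 hg
  have hmem : ∀ v : V, f v ∈ degreeLT F M := by
    intro v
    rw [hf]
    refine Submodule.sum_mem _ fun i _ => ?_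
    have hi := i.2
    have h1 : ∀ g : F[X], J + g.natDegree ≤ M → X ^ (i : ℕ) * g ∈ degreeLT F M := by
      intro g hg
      rw [mem_degreeLT]
      by_cases h0 : X ^ (i : ℕ) * g = 0
      · rw [h0, degree_zero]; exact WithBot.bot_lt_coe _
      · rw [← natDegree_lt_iff_degree_lt h0]
        refine lt_of_le_of_lt natDegree_mul_le ?_
        rw [natDegree_X_pow]; omega
    rw [mul_add]
    refine Submodule.add_mem _ (h1 _ ?_) (h1 _ ?_)
    · have := hlt _ (mem_degreeLT.1 (v i).1.2) ha
      rw [natDegree_expand, mul_comm]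
      have := Nat.mul_le_mul_left r this
      rw [mul_add, mul_one] at this
      omega
    · have := hlt _ (mem_degreeLT.1 (v i).2.2) he
      refine (Nat.add_le_add_left natDegree_mul_le _).trans ?_
      rw [natDegree_expand, mul_comm]
      have := Nat.mul_le_mul_left r this
      rw [mul_add, mul_one] at this
      omega
  have hfr : ∀ n, Module.finrank F (degreeLT F n) = n := fun n => by
    rw [(degreeLTEquiv F n).finrank_eq, Module.finrank_fin_fun]
  have hfin : ∀ n, FiniteDimensional F (degreeLT F n) := fun n =>
    (degreeLTEquiv F n).symm.finiteDimensional
  have := hfin a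
  have := hfin e
  have := hfin M
  have hker : (f.codRestrict _ hmem).ker ≠ ⊥ := by
    apply LinearMap.ker_ne_bot_of_finrank_lt
    rw [hfr M, Module.finrank_pi_fintype]
    simp only [Module.finrank_prod, hfr, Finset.sum_const, Finset.card_univ, Fintype.card_fin,
      smul_eq_mul]
    exact hdim
  obtain ⟨v, hv, hv0⟩ := (Submodule.ne_bot_iff _).1 hker
  refine ⟨fun i => (v i).1, fun i => (v i).2, fun i => mem_degreeLT.1 (v i).1.2,
    fun i => mem_degreeLT.1 (v i).2.2, ?_, ?_⟩
  · by_contra! hcon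
    apply hv0
    funext i
    exact Prod.ext (Subtype.ext (hcon i).1) (Subtype.ext (hcon i).2)
  · rw [← hf]
    simpa using congrArg Subtype.val hv

/-- **Stepanov's method**: an upper bound for the number of square values of a polynomial. -/
theorem two_mul_card_isSquare_eval_le [Fintype F] {p m d : ℕ} [Fact p.Prime] [CharP F p]
    (hp : p ≠ 2) (hcard : Fintype.card F = (p ^ m) ^ 2) (hd : 0 < d) (hm : 100 * d ≤ p ^ m)
    {D : F[X]} (hdeg : D.natDegree ≤ 2 * d) (hD0 : D.eval 0 ≠ 0)
    (hD : ∀ A E : F[X], ∀ c : F, c ≠ 0 → A ^ 2 = C c * D * E ^ 2 → E = 0) :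
    2 * Nat.card {x : F // IsSquare (D.eval x)} ≤ (p ^ m) ^ 2 + 15 * d * p ^ m := by
  classical
  have hodd : Odd (p ^ m) := ((Fact.out : p.Prime).odd_of_ne_two hp).pow
  set r := p ^ m with hr
  obtain ⟨k, hk⟩ := hodd
  obtain ⟨e, he⟩ : ∃ e, e = r / 4 := ⟨_, rfl⟩
  obtain ⟨J, hJ⟩ : ∃ J, J = (r + 8 * d + 5) / 2 := ⟨_, rfl⟩
  have hJ2 : 2 * J = r + 8 * d + 5 := by omega
  set W : F[X] := D ^ ((r + 1) / 2) with hW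
  have hWdeg : W.natDegree ≤ d * (r + 1) := by
    refine natDegree_pow_le.trans ((Nat.mul_le_mul_left _ hdeg).trans (le_of_eq ?_))
    have : (r + 1) / 2 * 2 = r + 1 := by omega
    calc (r + 1) / 2 * (2 * d) = d * ((r + 1) / 2 * 2) := by ring
      _ = _ := by rw [this]
  have h4 : 4 * e ≤ r := by omega
  have h4' : r ≤ 4 * e + 3 := by omega
  obtain ⟨A', E', hA', hE', ⟨i₀, hi₀⟩, hsum⟩ := exists_auxiliary_polynomials (F := F) (r := r)
    (J := J) (a := e + 2 * d) (e := e) (M := r * (e + 2 * d) + J - r) (W := W)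
    (by omega)
    (by
      have : r ≤ r * (e + 2 * d) := Nat.le_mul_of_pos_right _ (by omega)
      have h2 : d * 1 ≤ d * r := Nat.mul_le_mul_left _ (by omega)
      have h3 : r * (e + 2 * d) + J - r + r = r * (e + 2 * d) + J := by omega
      rw [h3]
      nlinarith)
    (by omega) (by omega)
    (by
      have : r ≤ r * (e + 2 * d) := Nat.le_mul_of_pos_right _ (by omega)
      have : r * (e + 2 * d) + J < J * (e + 2 * d + e) + r := by
        have h1 : 2 * (r * (e + 2 * d) + J) < 2 * (J * (e + 2 * d + e) + r) := by
          have e1 : 2 * (J * (e + 2 * d + e) + r) = (r + 8 * d + 5) * (2 * e + 2 * d) + 2 * r := by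
            rw [← hJ2]; ring
          rw [e1, mul_add, hJ2]
          have hed : d * r ≤ d * (4 * e + 3) := Nat.mul_le_mul_left _ h4'
          nlinarith
        omega
      omega)
  set φ := iterateFrobenius F p m with hφ
  have hφa : ∀ x, φ x = x ^ r := fun x => iterateFrobenius_def ..
  have hφφ : ∀ x, φ (φ x) = x := fun x => by
    rw [hφa, hφa, ← pow_mul, ← sq, ← hcard, FiniteField.pow_card]
  have hinj : Function.Injective φ := φ.injective
  have hnat : ∀ {n : ℕ} (g : F[X]), g.degree < n → 0 < n → (g.map φ).natDegree + 1 ≤ n := by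
    intro n g hg hn
    rw [natDegree_map]
    by_cases h0 : g = 0
    · simp [h0]; omega
    · exact (natDegree_lt_iff_degree_lt h0).2 hg
  have hAd : ∀ i, ((A' i).map φ).natDegree + 1 ≤ e + 2 * d := fun i => hnat _ (hA' i) (by omega)
  have hEd : ∀ i, ((E' i).map φ).natDegree + 1 ≤ e := fun i => hnat _ (hE' i) (by omega)
  let G : ℕ → F[X] := fun i => if h : i < J then
    (A' ⟨i, h⟩).map φ + (E' ⟨i, h⟩).map φ * W else 0
  have hG : ∀ i (h : i < J), X ^ r ∣ G i → (A' ⟨i, h⟩).map φ = 0 ∧ (E' ⟨i, h⟩).map φ = 0 := by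
    intro i h hdvd
    simp only [G, h, dif_pos] at hdvd
    refine eq_zero_of_X_pow_dvd_add_mul_pow hp hdeg hD0 hD ?_ ?_ hdvd
    · have := hAd ⟨i, h⟩; omega
    · have := hEd ⟨i, h⟩; omega
  let P : F[X] := ∑ i ∈ Finset.range J, X ^ (r * i) * G i
  have hP : P ≠ 0 := by
    intro hP0
    have h0 := eq_zero_of_sum_X_pow_mul_eq_zero G (fun i h hdvd => by
      obtain ⟨h1, h2⟩ := hG i h hdvd
      simp [G, h, h1, h2]) hP0 i₀ i₀.2
    obtain ⟨h1, h2⟩ := hG i₀ i₀.2 (h0 ▸ dvd_zero _)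
    rw [Polynomial.map_eq_zero] at h1 h2
    exact hi₀.elim (fun h => h h1) (fun h => h h2)
  have hroot : ∀ x, IsSquare (D.eval x) → P.IsRoot x := by
    rintro x ⟨y, hy⟩
    have hWx : (W.eval x) = y ^ (r + 1) := by
      rw [hW, eval_pow, hy, ← sq, ← pow_mul]
      congr 1; omega
    have hWr : φ (W.eval x) = W.eval x := by
      rw [hWx, map_pow, hφa, ← pow_mul, mul_add, mul_one, pow_add, ← sq, ← hcard,
        FiniteField.pow_card, pow_succ, mul_comm]
    have hmap : ∀ g : F[X], φ ((g.map φ).eval x) = (expand F r g).eval x := by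
      intro g
      rw [expand_eval, ← hφa]
      conv_lhs => rw [← hφφ x]
      rw [eval_map_apply, hφφ]
    have : φ (P.eval x) = 0 := by
      have h1 := congrArg (eval x) hsum
      rw [eval_zero, eval_finsetSum] at h1
      rw [← h1, eval_finsetSum, map_sum, Finset.sum_range]
      refine Finset.sum_congr rfl fun i _ => ?_
      simp only [G, i.2, dif_pos, eval_mul, eval_pow, eval_X, eval_add, map_mul, map_add, hmap,
        hWr, map_pow]
      rw [pow_mul, ← hφa, hφφ]
    exact (map_eq_zero_iff φ hinj).1 this
  have hPdeg : P.natDegree ≤ r * J + d * r := by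
    refine natDegree_sum_le_of_forall_le _ _ fun i hi => ?_
    rw [Finset.mem_range] at hi
    refine natDegree_mul_le.trans ?_
    rw [natDegree_X_pow]
    have h1 : (G i).natDegree ≤ r + d * r := by
      simp only [G, hi, dif_pos]
      refine (natDegree_add_le _ _).trans (max_le ?_ (natDegree_mul_le.trans ?_))
      · have := hAd ⟨i, hi⟩
        have : d * 1 ≤ d * r := Nat.mul_le_mul_left _ (by omega)
        omega
      · have := hEd ⟨i, hi⟩
        rw [mul_add] at hWdeg
        omega
    have h2 : r * (i + 1) ≤ r * J := Nat.mul_le_mul_left _ hi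
    rw [mul_add] at h2
    omega
  have hle : Nat.card {x : F // IsSquare (D.eval x)} ≤ P.natDegree := by
    rw [Nat.card_eq_fintype_card, Fintype.card_subtype]
    refine (Finset.card_le_card ?_).trans ((Multiset.toFinset_card_le P.roots).trans
      (card_roots' P))
    intro x hx
    rw [Multiset.mem_toFinset, mem_roots hP]
    exact hroot x (Finset.mem_filter.1 hx).2
  calc 2 * Nat.card {x : F // IsSquare (D.eval x)} ≤ r * (2 * J) + 2 * d * r := by
        linarith [hle.trans hPdeg]
    _ ≤ r ^ 2 + 15 * d * r := by
        rw [hJ2]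
        have : r * 1 ≤ r * d := Nat.mul_le_mul_left _ hd
        nlinarith

end Stepanov

section ArtinSchreier
open Polynomial

variable {F : Type*} [Field F]

theorem Squarefree.eq_zero_of_sq_eq_C_mul_mul_sq {D : F[X]} (hsq : Squarefree D)
    (hdeg : 0 < D.natDegree) (A E : F[X]) (c : F) (hc : c ≠ 0) (h : A ^ 2 = C c * D * E ^ 2) :
    E = 0 := by
  have hD0 : D ≠ 0 := fun h => by simp [h] at hdeg
  induction hn : E.natDegree using Nat.strong_induction_on generalizing A E with
  | _ n ih =>
    by_contra hE
    obtain ⟨B, rfl⟩ : D ∣ A := (hsq.dvd_pow_iff_dvd two_ne_zero).1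
      ⟨C c * E ^ 2, by rw [h]; ring⟩
    have h1 : D * B ^ 2 = C c * E ^ 2 := mul_left_cancel₀ hD0 (by linear_combination h)
    have hcc : C c⁻¹ * C c = 1 := by rw [← C_mul, inv_mul_cancel₀ hc, C_1]
    obtain ⟨E', rfl⟩ : D ∣ E := (hsq.dvd_pow_iff_dvd two_ne_zero).1
      ⟨C c⁻¹ * B ^ 2, by linear_combination (-C c⁻¹) * h1 - E ^ 2 * hcc⟩
    have h2 : B ^ 2 = C c * D * E' ^ 2 := mul_left_cancel₀ hD0 (by linear_combination h1)
    have hE' : E' ≠ 0 := right_ne_zero_of_mul hE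
    refine hE' (ih E'.natDegree ?_ B E' h2 rfl)
    rw [← hn, natDegree_mul hD0 hE']
    omega

theorem natDegree_X_pow_sub_X_add_C {p : ℕ} (hp : 1 < p) (t : F) :
    (X ^ p - X + C t : F[X]).natDegree = p := by
  rw [natDegree_add_C, FiniteField.X_pow_card_sub_X_natDegree_eq F hp]

theorem natDegree_sq_sub_C {p : ℕ} (hp : 1 < p) (t δ : F) :
    ((X ^ p - X + C t) ^ 2 - C δ : F[X]).natDegree = 2 * p := by
  rw [natDegree_sub_C, natDegree_pow, natDegree_X_pow_sub_X_add_C hp]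

theorem squarefree_sq_sub_C {p : ℕ} [Fact p.Prime] [CharP F p] (hp : p ≠ 2) (t : F) {δ : F}
    (hδ : δ ≠ 0) : Squarefree ((X ^ p - X + C t) ^ 2 - C δ : F[X]) := by
  refine Separable.squarefree ?_
  have h2 : (2 : F) ≠ 0 := Ring.two_ne_zero (by rwa [ringChar.eq F p])
  have hder : derivative ((X ^ p - X + C t) ^ 2 - C δ : F[X]) = - C 2 * (X ^ p - X + C t) := by
    simp [derivative_pow, CharP.cast_eq_zero]
  refine ⟨-C δ⁻¹, -C (δ⁻¹ * 2⁻¹) * (X ^ p - X + C t), ?_⟩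
  rw [hder]
  have e1 : C δ⁻¹ * C δ = (1 : F[X]) := by rw [← C_mul, inv_mul_cancel₀ hδ, C_1]
  have e2 : C (2⁻¹ : F) * C 2 = (1 : F[X]) := by rw [← C_mul, inv_mul_cancel₀ h2, C_1]
  rw [C_mul]
  linear_combination e1 + C δ⁻¹ * (X ^ p - X + C t) ^ 2 * e2

theorem exists_pow_sub_self_eq_of_trace_eq_zero [Fintype F] {p : ℕ} [Fact p.Prime]
    [Algebra (ZMod p) F] {y : F} (hy : Algebra.trace (ZMod p) F y = 0) : ∃ z, z ^ p - z = y := by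
  have : CharP F p := charP_of_injective_algebraMap (algebraMap (ZMod p) F).injective p
  let L : F →ₗ[ZMod p] F := (FiniteField.frobeniusAlgHom (ZMod p) F).toLinearMap - LinearMap.id
  have hL : ∀ z, L z = z ^ p - z := fun z => by simp [L, ZMod.card]
  have hker : L.ker ≤ Submodule.span (ZMod p) {1} := by
    intro z hz
    rw [LinearMap.mem_ker, hL, sub_eq_zero, ← Subfield.mem_bot_iff_pow_eq_self F p,
      ← ZMod.fieldRange_castHom_eq_bot p] at hz
    obtain ⟨c, rfl⟩ := hz
    rw [Submodule.mem_span_singleton]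
    refine ⟨c, ?_⟩
    rw [Algebra.smul_def, mul_one]
    exact RingHom.congr_fun (Subsingleton.elim _ _) c
  have hk1 : Module.finrank (ZMod p) L.ker ≤ 1 :=
    (Submodule.finrank_mono hker).trans ((finrank_span_le_card _).trans (by simp))
  have h1 := L.finrank_range_add_finrank_ker
  have h2 := (Algebra.trace (ZMod p) F).finrank_range_add_finrank_ker
  rw [LinearMap.range_eq_top.2 (Algebra.trace_surjective _ _), finrank_top,
    Module.finrank_self] at h2
  have hle : L.range ≤ (Algebra.trace (ZMod p) F).ker := by
    rintro _ ⟨z, rfl⟩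
    rw [LinearMap.mem_ker, hL, map_sub, sub_eq_zero]
    have := Algebra.trace_eq_of_algEquiv
      (FiniteField.frobeniusAlgEquivOfAlgebraic (ZMod p) F) z
    rwa [FiniteField.coe_frobeniusAlgEquivOfAlgebraic, ZMod.card] at this
  have heq := Submodule.eq_of_le_of_finrank_le hle (by omega)
  obtain ⟨z, hz⟩ : y ∈ L.range := heq ▸ LinearMap.mem_ker.2 hy
  exact ⟨z, by rw [← hz, hL]⟩

theorem prime_mul_card_trace_eq_le [Fintype F] {p m : ℕ} [Fact p.Prime] [Algebra (ZMod p) F]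
    (hp : p ≠ 2) (hcard : Fintype.card F = (p ^ m) ^ 2) (hm : 100 * p ≤ p ^ m)
    {a b : F} (ha : a ≠ 0) (hb : b ≠ 0) (s : ZMod p) :
    p * Nat.card {x : F // x ≠ 0 ∧ Algebra.trace (ZMod p) F (a * x + b * x⁻¹) = s} ≤
      (p ^ m) ^ 2 + 15 * p * p ^ m := by
  classical
  have : CharP F p := charP_of_injective_algebraMap (algebraMap (ZMod p) F).injective p
  have hp1 : 1 < p := (Fact.out : p.Prime).one_lt
  have h2 : (2 : F) ≠ 0 := Ring.two_ne_zero (by rwa [ringChar.eq F p])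
  set δ : F := 4 * a * b with hδ
  have hδ0 : δ ≠ 0 := by
    have : (4 : F) ≠ 0 := by
      have : (4 : F) = 2 * 2 := by norm_num
      rw [this]; exact mul_ne_zero h2 h2
    exact mul_ne_zero (mul_ne_zero this ha) hb
  have htr : ∀ z : F, Algebra.trace (ZMod p) F (z ^ p) = Algebra.trace (ZMod p) F z := by
    intro z
    have := Algebra.trace_eq_of_algEquiv
      (FiniteField.frobeniusAlgEquivOfAlgebraic (ZMod p) F) z
    rwa [FiniteField.coe_frobeniusAlgEquivOfAlgebraic, ZMod.card] at this
  obtain ⟨t, ht, ht0⟩ : ∃ t, Algebra.trace (ZMod p) F t = s ∧ t ^ 2 - δ ≠ 0 := by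
    obtain ⟨t₀, ht₀⟩ := Algebra.trace_surjective (ZMod p) F s
    have hne : ((X ^ p - X + C t₀) ^ 2 - C δ : F[X]) ≠ 0 := by
      intro h
      have := natDegree_sq_sub_C hp1 t₀ δ
      rw [h, natDegree_zero] at this
      omega
    obtain ⟨z, hz⟩ : ∃ z, eval z ((X ^ p - X + C t₀) ^ 2 - C δ : F[X]) ≠ 0 := by
      by_contra! hcon
      have h1 := Polynomial.card_le_degree_of_subset_roots (p := ((X ^ p - X + C t₀) ^ 2 - C δ))
        (Z := Finset.univ) (fun z _ => by
          rw [mem_roots hne]; exact hcon z)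
      rw [Finset.card_univ, hcard, natDegree_sq_sub_C hp1] at h1
      nlinarith
    refine ⟨z ^ p - z + t₀, ?_, by simpa using hz⟩
    rw [map_add, map_sub, htr, sub_self, zero_add, ht₀]
  set D : F[X] := (X ^ p - X + C t) ^ 2 - C δ with hD
  have hstep := two_mul_card_isSquare_eval_le (m := m) (d := p) (D := D) hp hcard (by omega) hm
    (natDegree_sq_sub_C hp1 t δ).le (by
      simpa [hD, (Fact.out : p.Prime).ne_zero] using ht0)
    ((squarefree_sq_sub_C hp t hδ0).eq_zero_of_sq_eq_C_mul_mul_sq (by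
      rw [natDegree_sq_sub_C hp1]; omega))
  let S := {x : F // x ≠ 0 ∧ Algebra.trace (ZMod p) F (a * x + b * x⁻¹) = s}
  let T : Finset (F × F) := Finset.univ.filter fun xz =>
    xz.1 ≠ 0 ∧ a * xz.1 + b * xz.1⁻¹ = xz.2 ^ p - xz.2 + t
  have hz : ∀ x : S, ∃ z, z ^ p - z = a * x.1 + b * x.1⁻¹ - t := fun x =>
    exists_pow_sub_self_eq_of_trace_eq_zero (by rw [map_sub, x.2.2, ht, sub_self])
  choose ζ hζ using hz
  have hcardT : p * Nat.card S ≤ T.card := by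
    have hmul : p * Nat.card S = (Finset.univ : Finset (ZMod p × S)).card := by
      rw [Finset.card_univ, Fintype.card_prod, ZMod.card, Nat.card_eq_fintype_card]
    rw [hmul]
    refine Finset.card_le_card_of_injOn
      (fun cx => (cx.2.1, ζ cx.2 + algebraMap (ZMod p) F cx.1)) ?_ ?_
    · rintro ⟨c, x⟩ -
      simp only [T, Finset.coe_filter, Finset.mem_univ, true_and, Set.mem_ofPred_eq]
      refine ⟨x.2.1, ?_⟩
      rw [add_pow_char, ← map_pow, ZMod.pow_card]
      linear_combination -hζ x
    · rintro ⟨c, x⟩ - ⟨c', x'⟩ - h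
      simp only [Prod.mk.injEq] at h
      obtain ⟨h1, h3⟩ := h
      obtain rfl : x = x' := Subtype.ext h1
      have := (algebraMap (ZMod p) F).injective (add_left_cancel h3)
      rw [this]
  have hquad : ∀ x w : F, x ≠ 0 → a * x + b * x⁻¹ = w → a * x ^ 2 - w * x + b = 0 := by
    rintro x w hx rfl
    field_simp
    ring
  have hTle : T.card ≤ 2 * (T.image Prod.snd).card := by
    refine Finset.card_le_mul_card_image _ _ fun z _ => ?_
    set w := z ^ p - z + t
    have hdeg : (C a * X ^ 2 + C (-w) * X + C b).natDegree = 2 := natDegree_quadratic ha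
    have hne : C a * X ^ 2 + C (-w) * X + C b ≠ 0 := fun h => by
      rw [h, natDegree_zero] at hdeg
      omega
    calc _ ≤ (C a * X ^ 2 + C (-w) * X + C b).roots.toFinset.card := by
          refine Finset.card_le_card_of_injOn Prod.fst ?_ ?_
          · rintro ⟨x, z'⟩ h
            simp only [T, Finset.coe_filter, Finset.mem_filter, Finset.mem_univ, true_and,
              Set.mem_ofPred_eq] at h
            obtain ⟨⟨hx, hxe⟩, rfl⟩ := h
            rw [Finset.mem_coe, Multiset.mem_toFinset, mem_roots hne, IsRoot.def]
            simp only [eval_add, eval_mul, eval_C, eval_pow, eval_X]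
            linear_combination hquad x _ hx hxe
          · rintro ⟨x, z₁⟩ h ⟨x', z₂⟩ h' he
            simp only [Finset.coe_filter, Set.mem_ofPred_eq] at h h'
            exact Prod.ext he (h.2.trans h'.2.symm)
      _ ≤ 2 := (Multiset.toFinset_card_le _).trans ((card_roots' _).trans hdeg.le)
  have himg : (T.image Prod.snd).card ≤ Nat.card {x : F // IsSquare (D.eval x)} := by
    rw [Nat.card_eq_fintype_card, Fintype.card_subtype]
    refine Finset.card_le_card fun z hz => ?_
    obtain ⟨⟨x, z'⟩, h, rfl⟩ := Finset.mem_image.1 hz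
    simp only [T, Finset.mem_filter, Finset.mem_univ, true_and] at h ⊢
    refine ⟨2 * a * x - (z' ^ p - z' + t), ?_⟩
    simp only [hD, hδ, eval_sub, eval_add, eval_pow, eval_X, eval_C]
    linear_combination -4 * a * hquad x _ h.1 h.2
  calc _ ≤ T.card := hcardT
    _ ≤ 2 * (T.image Prod.snd).card := hTle
    _ ≤ _ := (Nat.mul_le_mul_left 2 himg).trans hstep

end ArtinSchreier

section LFunction
open Polynomial UniqueFactorizationMonoid

variable {K : Type*} [Field K]

/-- The completely multiplicative function on monic polynomials which sends `∏ (X - xᵢ)` to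
`ψ (∑ (a xᵢ + b xᵢ⁻¹))`, and vanishes on the polynomials which vanish at `0`. -/
noncomputable def kloostermanWeight (ψ : AddChar K ℂ) (a b : K) (f : K[X]) : ℂ :=
  open Classical in
  if f.coeff 0 = 0 then 0 else ψ (-(a * f.nextCoeff) - b * (f.coeff 1 / f.coeff 0))

theorem kloostermanWeight_one (ψ : AddChar K ℂ) (a b : K) : kloostermanWeight ψ a b 1 = 1 := by
  simp [kloostermanWeight, coeff_one, nextCoeff]

theorem kloostermanWeight_mul (ψ : AddChar K ℂ) (a b : K) {f g : K[X]} (hf : f.Monic)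
    (hg : g.Monic) :
    kloostermanWeight ψ a b (f * g) = kloostermanWeight ψ a b f * kloostermanWeight ψ a b g := by
  unfold kloostermanWeight
  by_cases hf0 : f.coeff 0 = 0
  · simp [mul_coeff_zero, hf0]
  by_cases hg0 : g.coeff 0 = 0
  · simp [mul_coeff_zero, hg0]
  rw [if_neg hf0, if_neg hg0, if_neg (by simp [mul_coeff_zero, hf0, hg0]), ← AddChar.map_add_eq_mul,
    hf.nextCoeff_mul hg, mul_coeff_zero, mul_coeff_one]
  congr 1
  field_simp
  ring

theorem kloostermanWeight_pow (ψ : AddChar K ℂ) (a b : K) {f : K[X]} (hf : f.Monic) (j : ℕ) :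
    kloostermanWeight ψ a b (f ^ j) = kloostermanWeight ψ a b f ^ j := by
  induction j with
  | zero => simp [kloostermanWeight_one]
  | succ j ih => rw [pow_succ, pow_succ, kloostermanWeight_mul ψ a b (hf.pow j) hf, ih]

variable (K) in
theorem finite_monic_natDegree_eq [Finite K] (n : ℕ) :
    {f : K[X] | f.Monic ∧ f.natDegree = n}.Finite := by
  have : Finite (degreeLT K n) := Finite.of_equiv _ (degreeLTEquiv K n).symm.toEquiv
  have : Finite {f : K[X] // f.Monic ∧ f.natDegree = n} :=
    Finite.of_equiv _ (monicEquivDegreeLT n).symm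
  exact Set.finite_coe_iff.1 this

variable (K) in
/-- The monic polynomials of degree `n` over a finite field. -/
noncomputable def monicsOfDegree [Finite K] (n : ℕ) : Finset K[X] :=
  (finite_monic_natDegree_eq K n).toFinset

theorem mem_monicsOfDegree [Finite K] {n : ℕ} {f : K[X]} :
    f ∈ monicsOfDegree K n ↔ f.Monic ∧ f.natDegree = n := by
  simp [monicsOfDegree]

variable (K) in
/-- The monic irreducible polynomials of degree `n` over a finite field. -/
noncomputable def irreduciblesOfDegree [Finite K] (n : ℕ) : Finset K[X] :=
  open Classical in (monicsOfDegree K n).filter Irreducible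

theorem mem_irreduciblesOfDegree [Finite K] {n : ℕ} {f : K[X]} :
    f ∈ irreduciblesOfDegree K n ↔ f.Monic ∧ f.natDegree = n ∧ Irreducible f := by
  simp [irreduciblesOfDegree, mem_monicsOfDegree, and_assoc]

/-- The degree of a polynomial is the sum of the degrees of its prime power divisors. -/
theorem natDegree_eq_sum_prime_pow_dvd [Finite K] {n : ℕ} {f : K[X]} (hf : f.Monic)
    (hn : f.natDegree = n) :
    n = ∑ d ∈ Finset.Icc 1 n, ∑ j ∈ Finset.Icc 1 n, ∑ ϖ ∈ irreduciblesOfDegree K d,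
      open Classical in if ϖ ^ j ∣ f then d else 0 := by
  classical
  have h0 : (0 : K[X]) ∉ normalizedFactors f := zero_notMem_normalizedFactors f
  have hcount : ∀ ϖ : K[X], ϖ.Monic → Irreducible ϖ → ∀ j,
      ϖ ^ j ∣ f ↔ j ≤ (normalizedFactors f).count ϖ := by
    intro ϖ hm hi j
    rw [pow_dvd_iff_le_emultiplicity, emultiplicity_eq_count_normalizedFactors hi hf.ne_zero,
      hm.normalize_eq_self, Nat.cast_le]
  have hmem : ∀ ϖ ∈ normalizedFactors f,
      ϖ.Monic ∧ Irreducible ϖ ∧ ϖ.natDegree ∈ Finset.Icc 1 n := by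
    intro ϖ hϖ
    have hi := irreducible_of_normalized_factor ϖ hϖ
    refine ⟨?_, hi, ?_⟩
    · rw [← normalize_normalized_factor ϖ hϖ]
      exact monic_normalize hi.ne_zero
    · rw [Finset.mem_Icc]
      exact ⟨hi.natDegree_pos, hn ▸ natDegree_le_of_dvd (dvd_of_mem_normalizedFactors hϖ)
        hf.ne_zero⟩
  have hsum : n = ∑ ϖ ∈ (normalizedFactors f).toFinset,
      (normalizedFactors f).count ϖ * ϖ.natDegree := by
    have h := natDegree_multiset_prod _ h0
    rw [prod_normalizedFactors_eq hf.ne_zero, hf.normalize_eq_self, hn,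
      Finset.sum_multiset_map_count] at h
    simpa using h
  have hcle : ∀ ϖ : K[X], ϖ.Monic → Irreducible ϖ → (normalizedFactors f).count ϖ ≤ n := by
    intro ϖ hm hi
    have h1 := natDegree_le_of_dvd ((hcount ϖ hm hi _).2 le_rfl) hf.ne_zero
    rw [natDegree_pow, hn] at h1
    exact (Nat.le_mul_of_pos_right _ hi.natDegree_pos).trans h1
  conv_lhs => rw [hsum, ← Finset.sum_fiberwise_of_maps_to (t := Finset.Icc 1 n)
    (g := natDegree) (fun ϖ hϖ => (hmem ϖ (Multiset.mem_toFinset.1 hϖ)).2.2)]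
  refine Finset.sum_congr rfl fun d hd => ?_
  rw [Finset.sum_comm]
  have hsub : ((normalizedFactors f).toFinset.filter fun ϖ => ϖ.natDegree = d) ⊆
      irreduciblesOfDegree K d := by
    intro ϖ hϖ
    rw [Finset.mem_filter, Multiset.mem_toFinset] at hϖ
    exact mem_irreduciblesOfDegree.2 ⟨(hmem ϖ hϖ.1).1, hϖ.2, (hmem ϖ hϖ.1).2.1⟩
  rw [Finset.sum_subset hsub]
  · refine Finset.sum_congr rfl fun ϖ hϖ => ?_
    obtain ⟨hm, hdeg, hi⟩ := mem_irreduciblesOfDegree.1 hϖ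
    rw [hdeg, ← Finset.sum_filter, Finset.sum_const, smul_eq_mul]
    congr 1
    have : (Finset.Icc 1 n).filter (fun j => ϖ ^ j ∣ f) =
        Finset.Icc 1 ((normalizedFactors f).count ϖ) := by
      ext j
      have := hcle ϖ hm hi
      rw [Finset.mem_filter, Finset.mem_Icc, Finset.mem_Icc, hcount ϖ hm hi]
      omega
    rw [this, Nat.card_Icc]
    omega
  · intro ϖ hϖ hϖ'
    obtain ⟨hm, hdeg, hi⟩ := mem_irreduciblesOfDegree.1 hϖ
    rw [Finset.mem_filter, Multiset.mem_toFinset] at hϖ'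
    rw [Multiset.count_eq_zero.2 (fun h => hϖ' ⟨h, hdeg⟩), zero_mul]

theorem sum_monicsOfDegree_filter_dvd [Finite K] (ψ : AddChar K ℂ) (a b : K) {n k : ℕ} {g : K[X]}
    (hg : g.Monic) (hk : g.natDegree = k) (hkn : k ≤ n) :
    (∑ f ∈ monicsOfDegree K n, open Classical in
      if g ∣ f then kloostermanWeight ψ a b f else 0) =
      kloostermanWeight ψ a b g * ∑ h ∈ monicsOfDegree K (n - k), kloostermanWeight ψ a b h := by
  classical
  rw [← Finset.sum_filter, Finset.mul_sum]
  symm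
  refine Finset.sum_bij (fun h _ => g * h) ?_ ?_ ?_ ?_
  · intro h hh
    obtain ⟨hm, hd⟩ := mem_monicsOfDegree.1 hh
    rw [Finset.mem_filter, mem_monicsOfDegree, hg.natDegree_mul hm]
    exact ⟨⟨hg.mul hm, by omega⟩, dvd_mul_right _ _⟩
  · intro h _ h' _ e
    exact mul_left_cancel₀ hg.ne_zero e
  · intro f hf
    rw [Finset.mem_filter, mem_monicsOfDegree] at hf
    obtain ⟨⟨hm, hd⟩, h, rfl⟩ := hf
    have hmh := hg.of_mul_monic_left hm
    refine ⟨h, mem_monicsOfDegree.2 ⟨hmh, ?_⟩, rfl⟩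
    rw [hg.natDegree_mul hmh] at hd
    omega
  · intro h hh
    rw [kloostermanWeight_mul ψ a b hg (mem_monicsOfDegree.1 hh).1]

/-- The logarithmic derivative of the Euler product, compared coefficient by coefficient. -/
theorem natCast_mul_sum_kloostermanWeight [Finite K] (ψ : AddChar K ℂ) (a b : K) (n : ℕ) :
    n * ∑ f ∈ monicsOfDegree K n, kloostermanWeight ψ a b f =
      ∑ k ∈ Finset.Icc 1 n, (∑ d ∈ k.divisors, ∑ ϖ ∈ irreduciblesOfDegree K d,
        d * kloostermanWeight ψ a b ϖ ^ (k / d)) *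
        ∑ f ∈ monicsOfDegree K (n - k), kloostermanWeight ψ a b f := by
  classical
  set c : ℕ → ℂ := fun m => ∑ f ∈ monicsOfDegree K m, kloostermanWeight ψ a b f with hc
  have hzero : ∀ {d j : ℕ} {ϖ : K[X]}, ϖ ∈ irreduciblesOfDegree K d → n < d * j →
      ∑ f ∈ monicsOfDegree K n, (if ϖ ^ j ∣ f then kloostermanWeight ψ a b f else 0) = 0 := by
    intro d j ϖ hϖ hlt
    obtain ⟨hm, hdeg, hi⟩ := mem_irreduciblesOfDegree.1 hϖ
    refine Finset.sum_eq_zero fun f hf => if_neg fun hdvd => ?_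
    obtain ⟨hfm, hfd⟩ := mem_monicsOfDegree.1 hf
    have := natDegree_le_of_dvd hdvd hfm.ne_zero
    rw [natDegree_pow, hdeg, hfd, mul_comm] at this
    omega
  calc n * ∑ f ∈ monicsOfDegree K n, kloostermanWeight ψ a b f
      = ∑ f ∈ monicsOfDegree K n, ∑ d ∈ Finset.Icc 1 n, ∑ j ∈ Finset.Icc 1 n,
          ∑ ϖ ∈ irreduciblesOfDegree K d,
            (d : ℂ) * if ϖ ^ j ∣ f then kloostermanWeight ψ a b f else 0 := by
        rw [Finset.mul_sum]
        refine Finset.sum_congr rfl fun f hf => ?_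
        obtain ⟨hfm, hfd⟩ := mem_monicsOfDegree.1 hf
        conv_lhs => rw [natDegree_eq_sum_prime_pow_dvd hfm hfd]
        push_cast
        simp only [Finset.sum_mul]
        refine Finset.sum_congr rfl fun d _ => Finset.sum_congr rfl fun j _ =>
          Finset.sum_congr rfl fun ϖ _ => ?_
        split_ifs <;> simp
    _ = ∑ d ∈ Finset.Icc 1 n, ∑ j ∈ Finset.Icc 1 n, ∑ ϖ ∈ irreduciblesOfDegree K d,
          (d : ℂ) * ∑ f ∈ monicsOfDegree K n,
            if ϖ ^ j ∣ f then kloostermanWeight ψ a b f else 0 := by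
        rw [Finset.sum_comm]
        refine Finset.sum_congr rfl fun d _ => ?_
        rw [Finset.sum_comm]
        refine Finset.sum_congr rfl fun j _ => ?_
        rw [Finset.sum_comm]
        simp only [Finset.mul_sum]
    _ = ∑ x ∈ (Finset.Icc 1 n ×ˢ Finset.Icc 1 n).filter (fun x => x.1 * x.2 ∈ Finset.Icc 1 n),
          (∑ ϖ ∈ irreduciblesOfDegree K x.1, (x.1 : ℂ) * kloostermanWeight ψ a b ϖ ^ x.2) *
            c (n - x.1 * x.2) := by
        rw [← Finset.sum_product', Finset.sum_filter]
        refine Finset.sum_congr rfl fun ⟨d, j⟩ hx => ?_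
        rw [Finset.mem_product, Finset.mem_Icc, Finset.mem_Icc] at hx
        dsimp only at hx ⊢
        split_ifs with h
        · rw [Finset.mem_Icc] at h
          rw [Finset.sum_mul]
          refine Finset.sum_congr rfl fun ϖ hϖ => ?_
          obtain ⟨hm, hdeg, hi⟩ := mem_irreduciblesOfDegree.1 hϖ
          rw [sum_monicsOfDegree_filter_dvd ψ a b (hm.pow j)
            (by rw [natDegree_pow, hdeg, mul_comm]) h.2, kloostermanWeight_pow ψ a b hm, mul_assoc]
        · refine Finset.sum_eq_zero fun ϖ hϖ => ?_
          have : 0 < d * j := Nat.mul_pos hx.1.1 hx.2.1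
          rw [Finset.mem_Icc] at h
          rw [hzero hϖ (by omega), mul_zero]
    _ = ∑ k ∈ Finset.Icc 1 n, ∑ x ∈ k.divisorsAntidiagonal,
          (∑ ϖ ∈ irreduciblesOfDegree K x.1, (x.1 : ℂ) * kloostermanWeight ψ a b ϖ ^ x.2) *
            c (n - k) := by
        rw [← Finset.sum_fiberwise_of_maps_to (t := Finset.Icc 1 n)
          (g := fun x : ℕ × ℕ => x.1 * x.2)
          (fun x hx => (Finset.mem_filter.1 hx).2)]
        refine Finset.sum_congr rfl fun k hk => ?_
        rw [Finset.mem_Icc] at hk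
        refine Finset.sum_congr ?_ ?_
        · ext ⟨d, j⟩
          simp only [Finset.mem_filter, Finset.mem_product, Finset.mem_Icc,
            Nat.mem_divisorsAntidiagonal]
          constructor
          · rintro ⟨-, rfl⟩
            exact ⟨rfl, by omega⟩
          · rintro ⟨rfl, h⟩
            have hd : 0 < d := Nat.pos_of_ne_zero fun h0 => by simp [h0] at h
            have hj : 0 < j := Nat.pos_of_ne_zero fun h0 => by simp [h0] at h
            have := Nat.le_mul_of_pos_right d hj
            have := Nat.le_mul_of_pos_left j hd
            refine ⟨⟨⟨⟨?_, ?_⟩, ?_, ?_⟩, ?_, ?_⟩, rfl⟩ <;> omega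
        · rintro ⟨d, j⟩ hx
          rw [(Nat.mem_divisorsAntidiagonal.1 hx).1]
    _ = _ := by
        refine Finset.sum_congr rfl fun k _ => ?_
        rw [← Finset.sum_mul, Nat.sum_divisorsAntidiagonal
          (fun d j => ∑ ϖ ∈ irreduciblesOfDegree K d, (d : ℂ) * kloostermanWeight ψ a b ϖ ^ j)]

theorem sum_monicsOfDegree_zero [Finite K] (ψ : AddChar K ℂ) (a b : K) :
    ∑ f ∈ monicsOfDegree K 0, kloostermanWeight ψ a b f = 1 := by
  have : monicsOfDegree K 0 = {1} := by
    ext f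
    rw [mem_monicsOfDegree, Finset.mem_singleton]
    exact ⟨fun h => h.1.natDegree_eq_zero.1 h.2, fun h => by simp [h]⟩
  rw [this, Finset.sum_singleton, kloostermanWeight_one]

theorem kloostermanWeight_X_sub_C (ψ : AddChar K ℂ) (a b x : K) :
    kloostermanWeight ψ a b (X - C x) =
      open Classical in if x = 0 then 0 else ψ (a * x + b * x⁻¹) := by
  unfold kloostermanWeight
  by_cases hx : x = 0
  · simp [hx]
  · rw [if_neg (by simpa using hx), if_neg hx, nextCoeff_X_sub_C]
    congr 1
    simp [coeff_X, coeff_C]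

theorem sum_monicsOfDegree_one [Fintype K] (ψ : AddChar K ℂ) (a b : K) :
    ∑ f ∈ monicsOfDegree K 1, kloostermanWeight ψ a b f =
      ∑ x : K, open Classical in if x = 0 then 0 else ψ (a * x + b * x⁻¹) := by
  symm
  refine Finset.sum_bij (fun x _ => X - C x) ?_ ?_ ?_ ?_
  · intro x _
    exact mem_monicsOfDegree.2 ⟨monic_X_sub_C x, natDegree_X_sub_C x⟩
  · intro x _ y _ h
    simpa using h
  · intro f hf
    obtain ⟨hm, hd⟩ := mem_monicsOfDegree.1 hf
    refine ⟨-f.coeff 0, Finset.mem_univ _, ?_⟩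
    rw [hm.eq_X_add_C hd]
    simp
  · intro x _
    rw [kloostermanWeight_X_sub_C]

theorem sum_addChar_mul_eq_zero [Fintype K] {ψ : AddChar K ℂ} (hψ : ψ ≠ 1) {c : K} (hc : c ≠ 0) :
    ∑ x : K, ψ (c * x) = 0 := by
  classical
  have := AddChar.sum_mulShift c (AddChar.IsPrimitive.of_ne_one hψ)
  simpa [mul_comm, hc] using this

theorem sum_monicsOfDegree_two [Fintype K] {ψ : AddChar K ℂ} (hψ : ψ ≠ 1) {a b : K}
    (ha : a ≠ 0) (hb : b ≠ 0) :
    ∑ f ∈ monicsOfDegree K 2, kloostermanWeight ψ a b f = Fintype.card K := by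
  classical
  have hbij : ∑ f ∈ monicsOfDegree K 2, kloostermanWeight ψ a b f =
      ∑ y : K × K, if y.1 = 0 then 0 else ψ (-(a * y.2) - b * (y.2 / y.1)) := by
    symm
    refine Finset.sum_bij (fun y _ => X ^ 2 + C y.2 * X + C y.1) ?_ ?_ ?_ ?_
    · intro y _
      exact mem_monicsOfDegree.2 ⟨by monicity!, by compute_degree!⟩
    · rintro ⟨x, y⟩ _ ⟨x', y'⟩ _ h
      have h0 := congrArg (coeff · 0) h
      have h1 := congrArg (coeff · 1) h
      simp [coeff_X, coeff_C] at h0 h1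
      simp [h0, h1]
    · intro f hf
      obtain ⟨hm, hd⟩ := mem_monicsOfDegree.1 hf
      refine ⟨(f.coeff 0, f.coeff 1), Finset.mem_univ _, ?_⟩
      conv_rhs => rw [hm.as_sum, hd]
      simp [Finset.sum_range_succ]
      ring
    · rintro ⟨x, y⟩ _
      have hd : (X ^ 2 + C y * X + C x : K[X]).natDegree = 2 := by compute_degree!
      have hn : (X ^ 2 + C y * X + C x : K[X]).nextCoeff = y := by
        rw [nextCoeff_of_natDegree_pos (by omega), hd]
        simp [coeff_C]
      unfold kloostermanWeight
      rw [hn]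
      simp [coeff_C]
  have hc : ∀ x : K, (a + b / x = 0 ∧ x ≠ 0) ↔ x = -b / a := by
    intro x
    constructor
    · rintro ⟨h, hx⟩
      field_simp at h ⊢
      linear_combination h
    · rintro rfl
      have : -b / a ≠ 0 := div_ne_zero (neg_ne_zero.2 hb) ha
      refine ⟨?_, this⟩
      field_simp
      ring
  rw [hbij, Fintype.sum_prod_type]
  have hin : ∀ x : K, ∑ y : K, (if x = 0 then 0 else ψ (-(a * y) - b * (y / x))) =
      if x = -b / a then (Fintype.card K : ℂ) else 0 := by
    intro x
    rw [← hc]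
    by_cases hx : x = 0
    · simp [hx]
    by_cases h : a + b / x = 0
    · rw [if_pos ⟨h, hx⟩]
      have : ∀ y, (if x = 0 then 0 else ψ (-(a * y) - b * (y / x))) = 1 := by
        intro y
        rw [if_neg hx, show -(a * y) - b * (y / x) = -((a + b / x) * y) by ring, h]
        simp
      simp [this]
    · rw [if_neg (fun h' => h h'.1), ← sum_addChar_mul_eq_zero hψ (neg_ne_zero.2 h)]
      refine Finset.sum_congr rfl fun y _ => ?_
      rw [if_neg hx]
      congr 1
      ring
  rw [Finset.sum_congr rfl fun x _ => hin x]
  simp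

theorem sum_monicsOfDegree_eq_zero [Finite K] {ψ : AddChar K ℂ} (hψ : ψ ≠ 1) {a : K}
    (ha : a ≠ 0) (b : K) {n : ℕ} (hn : 3 ≤ n) :
    ∑ f ∈ monicsOfDegree K n, kloostermanWeight ψ a b f = 0 := by
  obtain ⟨t, ht⟩ : ∃ t, ψ t ≠ 1 := by
    by_contra! h
    exact hψ (by ext x; simp [h])
  set c : K := -(a⁻¹ * t)
  have hmaps : ∀ e : K, ∀ f ∈ monicsOfDegree K n, f + C e * X ^ (n - 1) ∈ monicsOfDegree K n := by
    intro e f hf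
    obtain ⟨hm, hd⟩ := mem_monicsOfDegree.1 hf
    have hlt : (C e * X ^ (n - 1)).degree < f.degree := by
      rw [degree_eq_natDegree hm.ne_zero]
      refine (degree_C_mul_X_pow_le _ _).trans_lt ?_
      rw [hd]
      exact_mod_cast (by omega : n - 1 < n)
    refine mem_monicsOfDegree.2 ⟨hm.add_of_left hlt, ?_⟩
    rw [natDegree_add_eq_left_of_degree_lt hlt, hd]
  have hw : ∀ f ∈ monicsOfDegree K n,
      kloostermanWeight ψ a b (f + C c * X ^ (n - 1)) = ψ t * kloostermanWeight ψ a b f := by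
    intro f hf
    have hd := (mem_monicsOfDegree.1 hf).2
    have hd' := (mem_monicsOfDegree.1 (hmaps c f hf)).2
    unfold kloostermanWeight
    have h0 : (f + C c * X ^ (n - 1)).coeff 0 = f.coeff 0 := by
      rw [coeff_add, coeff_C_mul_X_pow, if_neg (by omega), add_zero]
    have h1 : (f + C c * X ^ (n - 1)).coeff 1 = f.coeff 1 := by
      rw [coeff_add, coeff_C_mul_X_pow, if_neg (by omega), add_zero]
    have h2 : (f + C c * X ^ (n - 1)).nextCoeff = f.nextCoeff + c := by
      rw [nextCoeff_of_natDegree_pos (by omega), nextCoeff_of_natDegree_pos (by omega), hd, hd',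
        coeff_add, coeff_C_mul_X_pow, if_pos rfl]
    rw [h0, h1, h2]
    split_ifs
    · simp
    · rw [← AddChar.map_add_eq_mul]
      congr 1
      simp only [c]
      field_simp
      ring
  have key : ∑ f ∈ monicsOfDegree K n, kloostermanWeight ψ a b f =
      ψ t * ∑ f ∈ monicsOfDegree K n, kloostermanWeight ψ a b f := by
    rw [Finset.mul_sum, ← Finset.sum_congr rfl hw]
    symm
    refine Finset.sum_bij' (fun f _ => f + C c * X ^ (n - 1)) (fun f _ => f + C (-c) * X ^ (n - 1))
      (hmaps c) (hmaps (-c)) ?_ ?_ ?_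
    · intro f _; simp
    · intro f _; simp
    · intro f _; rfl
  have : (1 - ψ t) * ∑ f ∈ monicsOfDegree K n, kloostermanWeight ψ a b f = 0 := by
    linear_combination key
  exact (mul_eq_zero.1 this).resolve_left (sub_ne_zero.2 (Ne.symm ht))

open IntermediateField in
theorem natDegree_minpoly_inv {F : Type*} [Field F] [Algebra K F] [FiniteDimensional K F] (x : F) :
    (minpoly K x⁻¹).natDegree = (minpoly K x).natDegree := by
  have : K⟮x⁻¹⟯ = K⟮x⟯ := by
    apply le_antisymm
    · exact adjoin_simple_le_iff.2 (inv_mem (mem_adjoin_simple_self K x))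
    · refine adjoin_simple_le_iff.2 ?_
      have := inv_mem (mem_adjoin_simple_self K x⁻¹)
      rwa [inv_inv] at this
  rw [← adjoin.finrank (.of_finite K x), ← adjoin.finrank (.of_finite K x⁻¹), this]

theorem minpoly_inv {F : Type*} [Field F] [Algebra K F] [FiniteDimensional K F] {x : F}
    (hx : x ≠ 0) :
    minpoly K x⁻¹ = C ((minpoly K x).coeff 0)⁻¹ * (minpoly K x).reverse := by
  have h0 := minpoly.coeff_zero_ne_zero (.of_finite K x) hx
  have hne := minpoly.ne_zero_of_finite K x
  have htd : (minpoly K x).natTrailingDegree = 0 := natTrailingDegree_eq_zero.2 (Or.inr h0)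
  symm
  refine minpoly.unique_of_degree_le_degree_minpoly K x⁻¹ ?_ ?_ ?_
  · rw [Monic, leadingCoeff_mul, leadingCoeff_C, reverse_leadingCoeff, trailingCoeff, htd,
      inv_mul_cancel₀ h0]
  · let := invertibleOfNonzero hx
    have := (eval₂_reverse_eq_zero_iff (algebraMap K F) x (minpoly K x)).2 (minpoly.aeval K x)
    rw [invOf_eq_inv] at this
    rw [map_mul, aeval_def, aeval_def, this, mul_zero]
  · rw [degree_C_mul (inv_ne_zero h0), degree_eq_natDegree (minpoly.ne_zero_of_finite K x⁻¹),
      natDegree_minpoly_inv, degree_eq_natDegree (by simpa using hne)]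
    exact_mod_cast reverse_natDegree_le _

theorem nextCoeff_minpoly_inv {F : Type*} [Field F] [Algebra K F] [FiniteDimensional K F] {x : F}
    (hx : x ≠ 0) :
    (minpoly K x⁻¹).nextCoeff = (minpoly K x).coeff 1 / (minpoly K x).coeff 0 := by
  have hpos := minpoly.natDegree_pos (.of_finite K x : IsIntegral K x)
  rw [nextCoeff_of_natDegree_pos (by rwa [natDegree_minpoly_inv]), natDegree_minpoly_inv,
    minpoly_inv hx, coeff_C_mul, coeff_reverse, revAt_le (by omega),
    show (minpoly K x).natDegree - ((minpoly K x).natDegree - 1) = 1 by omega]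
  ring

open IntermediateField in
theorem kloostermanWeight_minpoly_pow {F : Type*} [Field F] [Algebra K F] [FiniteDimensional K F]
    (ψ : AddChar K ℂ) (a b : K) (x : F) :
    kloostermanWeight ψ a b (minpoly K x) ^ (Module.finrank K F / (minpoly K x).natDegree) =
      open Classical in if x = 0 then 0 else
        ψ (Algebra.trace K F (algebraMap K F a * x + algebraMap K F b * x⁻¹)) := by
  have hpos := minpoly.natDegree_pos (.of_finite K x : IsIntegral K x)
  have hfin : ∀ y : F, (minpoly K y).natDegree * Module.finrank K⟮y⟯ F = Module.finrank K F := by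
    intro y
    rw [← adjoin.finrank (.of_finite K y), Module.finrank_mul_finrank]
  have hdvd : ∀ y : F, Module.finrank K F / (minpoly K y).natDegree = Module.finrank K⟮y⟯ F := by
    intro y
    rw [← hfin y,
      Nat.mul_div_cancel_left _ (minpoly.natDegree_pos (.of_finite K y : IsIntegral K y))]
  have hr : Module.finrank K⟮x⁻¹⟯ F = Module.finrank K⟮x⟯ F := by
    rw [← hdvd, ← hdvd, natDegree_minpoly_inv]
  rw [hdvd]
  unfold kloostermanWeight
  by_cases hx : x = 0
  · rw [if_pos hx, if_pos ((minpoly.coeff_zero_eq_zero (.of_finite K x)).2 hx), zero_pow]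
    intro h
    have := hfin x
    rw [h, mul_zero] at this
    exact Module.finrank_pos.ne this
  · rw [if_neg hx, if_neg (minpoly.coeff_zero_ne_zero (.of_finite K x) hx),
      ← AddChar.map_nsmul_eq_pow]
    congr 1
    rw [map_add, ← Algebra.smul_def, ← Algebra.smul_def, map_smul, map_smul,
      trace_eq_finrank_mul_minpoly_nextCoeff, trace_eq_finrank_mul_minpoly_nextCoeff, hr,
      nextCoeff_minpoly_inv hx]
    simp only [nsmul_eq_mul, smul_eq_mul]
    ring

theorem card_filter_minpoly_eq [Finite K] {F : Type*} [Field F] [Fintype F] [Algebra K F]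
    {g : K[X]} (hm : g.Monic) (hi : Irreducible g) (hd : g.natDegree ∣ Module.finrank K F) :
    (open Classical in Finset.univ.filter fun x : F => minpoly K x = g).card = g.natDegree := by
  classical
  have hsep : g.Separable := PerfectField.separable_of_irreducible hi
  have hsplit : (g.map (algebraMap K F)).Splits := by
    have h1 := (Irreducible.natDegree_dvd_iff_dvd_X_pow_card_pow_sub_X (n := Module.finrank K F)
      hi).1 hd
    have h2 := map_dvd (mapRingHom (algebraMap K F)) h1
    rw [← Module.natCard_eq_pow_finrank (K := K) (V := F)] at h2
    simp only [coe_mapRingHom, Polynomial.map_sub, Polynomial.map_pow, map_X,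
      Nat.card_eq_fintype_card] at h2
    refine Splits.of_dvd ?_ (FiniteField.X_pow_card_sub_X_ne_zero F Fintype.one_lt_card) h2
    rw [splits_iff_card_roots, FiniteField.roots_X_pow_card_sub_X,
      FiniteField.X_pow_card_sub_X_natDegree_eq F Fintype.one_lt_card]
    rfl
  rw [← card_rootSet_eq_natDegree hsep hsplit, ← Set.toFinset_card]
  congr 1
  ext x
  rw [Finset.mem_filter, Set.mem_toFinset, mem_rootSet]
  constructor
  · rintro ⟨-, rfl⟩
    exact ⟨hm.ne_zero, minpoly.aeval K x⟩
  · rintro ⟨-, h⟩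
    exact ⟨Finset.mem_univ _, (minpoly.eq_of_irreducible_of_monic hi h hm).symm⟩

theorem sum_trace_eq_sum_irreduciblesOfDegree [Finite K] {F : Type*} [Field F] [Fintype F]
    [Algebra K F] (ψ : AddChar K ℂ) (a b : K) :
    (∑ x : F, open Classical in if x = 0 then 0 else
      ψ (Algebra.trace K F (algebraMap K F a * x + algebraMap K F b * x⁻¹))) =
    ∑ d ∈ (Module.finrank K F).divisors, ∑ g ∈ irreduciblesOfDegree K d,
      d * kloostermanWeight ψ a b g ^ (Module.finrank K F / d) := by
  classical
  simp only [← kloostermanWeight_minpoly_pow]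
  rw [← Finset.sum_fiberwise_of_maps_to (t := (Module.finrank K F).divisors)
    (g := fun x : F => (minpoly K x).natDegree)]
  · refine Finset.sum_congr rfl fun d hd => ?_
    rw [← Finset.sum_fiberwise_of_maps_to (t := irreduciblesOfDegree K d)
      (g := fun x : F => minpoly K x)]
    · refine Finset.sum_congr rfl fun g hg => ?_
      obtain ⟨hm, hgd, hi⟩ := mem_irreduciblesOfDegree.1 hg
      have hcard := card_filter_minpoly_eq (F := F) hm hi
        (by rw [hgd]; exact Nat.dvd_of_mem_divisors hd)
      have hfilt : ((Finset.univ.filter fun x : F => (minpoly K x).natDegree = d).filter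
          fun x => minpoly K x = g) = Finset.univ.filter fun x : F => minpoly K x = g := by
        ext x
        simp only [Finset.mem_filter, Finset.mem_univ, true_and, and_iff_right_iff_imp]
        rintro rfl
        exact hgd
      rw [hfilt, ← hgd, ← nsmul_eq_mul, ← hcard, ← Finset.sum_const, hcard]
      refine Finset.sum_congr rfl fun x hx => ?_
      rw [(Finset.mem_filter.1 hx).2]
    · intro x hx
      exact mem_irreduciblesOfDegree.2 ⟨minpoly.monic (.of_finite K x), (Finset.mem_filter.1 hx).2,
        minpoly.irreducible (.of_finite K x)⟩
  · intro x _
    exact Nat.mem_divisors.2 ⟨minpoly.degree_dvd (.of_finite K x), Module.finrank_pos.ne'⟩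

/-- The Kloosterman sum over `K` has the shape `-(α + β)` with `α β = |K|`, and its lift to the
extension of degree `n` is `-(α ^ n + β ^ n)`. -/
theorem exists_add_pow_eq_neg_sum_trace {K : Type*} [Field K] [Fintype K] {ψ : AddChar K ℂ}
    (hψ : ψ ≠ 1) {a b : K} (ha : a ≠ 0) (hb : b ≠ 0) :
    ∃ α β : ℂ, (∑ x : K, open Classical in if x = 0 then 0 else ψ (a * x + b * x⁻¹)) = -(α + β) ∧
      α * β = Fintype.card K ∧
      ∀ (F : Type) [Field F] [Fintype F] [Algebra K F],
        (∑ x : F, open Classical in if x = 0 then 0 else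
          ψ (Algebra.trace K F (algebraMap K F a * x + algebraMap K F b * x⁻¹))) =
        -(α ^ Module.finrank K F + β ^ Module.finrank K F) := by
  classical
  set c : ℕ → ℂ := fun n => ∑ f ∈ monicsOfDegree K n, kloostermanWeight ψ a b f with hc
  set P : ℕ → ℂ := fun k => ∑ d ∈ k.divisors, ∑ g ∈ irreduciblesOfDegree K d,
    d * kloostermanWeight ψ a b g ^ (k / d) with hP
  have newton : ∀ n : ℕ, n * c n = ∑ k ∈ Finset.Icc 1 n, P k * c (n - k) :=
    natCast_mul_sum_kloostermanWeight ψ a b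
  have hc0 : c 0 = 1 := sum_monicsOfDegree_zero ψ a b
  have hc1 := sum_monicsOfDegree_one ψ a b
  have hc2 : c 2 = Fintype.card K := sum_monicsOfDegree_two hψ ha hb
  have hc3 : ∀ n, 3 ≤ n → c n = 0 := fun n hn => sum_monicsOfDegree_eq_zero hψ ha b hn
  obtain ⟨s, hs⟩ := IsAlgClosed.exists_pow_nat_eq (c 1 ^ 2 - 4 * Fintype.card K) (n := 2) two_pos
  set α : ℂ := (-c 1 + s) / 2
  set β : ℂ := (-c 1 - s) / 2
  have hadd : α + β = -c 1 := by ring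
  have hmul : α * β = Fintype.card K := by
    linear_combination (-1 / 4 : ℂ) * hs
  have hP1 : P 1 = -(α ^ 1 + β ^ 1) := by
    have := newton 1
    simp [hc0] at this
    rw [← this, pow_one, pow_one, hadd, neg_neg]
  have hP2 : P 2 = -(α ^ 2 + β ^ 2) := by
    have := newton 2
    rw [Finset.sum_Icc_succ_top (by omega), Finset.sum_Icc_succ_top (by omega)] at this
    simp [hc0, hc2, hP1] at this
    linear_combination -this + (α + β) * hadd - 2 * hmul
  have hPn : ∀ n, P (n + 1) = -(α ^ (n + 1) + β ^ (n + 1)) ∧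
      P (n + 2) = -(α ^ (n + 2) + β ^ (n + 2)) := by
    intro n
    induction n with
    | zero => exact ⟨hP1, hP2⟩
    | succ n ih =>
      refine ⟨ih.2, ?_⟩
      have := newton (n + 3)
      rw [Finset.sum_Icc_succ_top (by omega), Finset.sum_Icc_succ_top (by omega),
        Finset.sum_Icc_succ_top (by omega), hc3 _ (by omega),
        Finset.sum_eq_zero fun k hk => by
          rw [Finset.mem_Icc] at hk
          rw [hc3 _ (by omega), mul_zero],
        show n + 3 - (n + 1) = 2 by omega, show n + 3 - (n + 1 + 1) = 1 by omega,
        show n + 3 - (n + 2 + 1) = 0 by omega, hc0, hc2, ← hmul, ih.1, ih.2,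
        show c 1 = -(α + β) by rw [hadd, neg_neg]] at this
      linear_combination -this
  refine ⟨α, β, ?_, hmul, fun F _ _ _ => ?_⟩
  · rw [hadd, neg_neg, ← hc1]
  · rw [sum_trace_eq_sum_irreduciblesOfDegree]
    obtain ⟨n, hn⟩ := Nat.exists_eq_succ_of_ne_zero (Module.finrank_pos (R := K) (M := F)).ne'
    have := (hPn n).1
    rw [← Nat.succ_eq_add_one, ← hn] at this
    exact this

end LFunction

section Prime

/-- If `α β = q` and the power sums of `α, β` grow at most like those of `√q`, then
`|α| ≤ √q`. -/
theorem norm_sq_le_of_norm_add_pow_le {α β : ℂ} {q C : ℝ} {M : ℕ} (hq : 0 < q)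
    (hmul : ‖α‖ * ‖β‖ = q)
    (h : ∀ m, M ≤ m → ‖α ^ (2 * m) + β ^ (2 * m)‖ ≤ C * q ^ m) : ‖α‖ ^ 2 ≤ q := by
  by_contra! hlt
  have hA : 1 < ‖α‖ ^ 2 / q := (one_lt_div hq).2 hlt
  have hB : ‖β‖ ^ 2 / q ≤ 1 := by
    have : (‖α‖ ^ 2 / q) * (‖β‖ ^ 2 / q) = 1 := by
      field_simp
      rw [← hmul]
      ring
    by_contra! hB
    nlinarith
  obtain ⟨m, hm⟩ := ((tendsto_pow_atTop_atTop_of_one_lt hA).eventually_gt_atTop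
    (C + 1)).exists_forall_of_atTop
  have h1 := hm (max m M) (le_max_left _ _)
  have h2 := h (max m M) (le_max_right _ _)
  set k := max m M
  have h3 : ‖α‖ ^ (2 * k) ≤ ‖α ^ (2 * k) + β ^ (2 * k)‖ + ‖β‖ ^ (2 * k) := by
    rw [← norm_pow, ← norm_pow]
    simpa using norm_sub_le (α ^ (2 * k) + β ^ (2 * k)) (β ^ (2 * k))
  have h4 : ‖β‖ ^ (2 * k) ≤ q ^ k := by
    rw [pow_mul]
    exact pow_le_pow_left₀ (by positivity) ((div_le_one hq).1 hB) k
  rw [div_pow, lt_div_iff₀ (by positivity), ← pow_mul] at h1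
  linarith

/-- Equidistribution of the trace up to `O(√|F|)` gives square root cancellation. -/
theorem norm_sum_addChar_trace_le {F : Type*} [Field F] [Fintype F] {p m : ℕ} [Fact p.Prime]
    [Algebra (ZMod p) F] (hp : p ≠ 2) (hcard : Fintype.card F = (p ^ m) ^ 2)
    (hm : 100 * p ≤ p ^ m) {a b : F} (ha : a ≠ 0) (hb : b ≠ 0) {ψ : AddChar (ZMod p) ℂ}
    (hψ : ψ ≠ 1) :
    ‖∑ x : F, open Classical in if x = 0 then 0 else
      ψ (Algebra.trace (ZMod p) F (a * x + b * x⁻¹))‖ ≤ 16 * p * (p : ℝ) ^ m := by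
  classical
  have hp0 : (0 : ℝ) < p := by exact_mod_cast (Fact.out : p.Prime).pos
  have hp1 : (1 : ℝ) ≤ p := by exact_mod_cast (Fact.out : p.Prime).one_le
  set A : ZMod p → ℕ := fun s =>
    (Finset.univ.filter fun x : F => x ≠ 0 ∧
      Algebra.trace (ZMod p) F (a * x + b * x⁻¹) = s).card with hA
  have hAle : ∀ s, p * A s ≤ (p ^ m) ^ 2 + 15 * p * p ^ m := by
    intro s
    have := prime_mul_card_trace_eq_le hp hcard hm ha hb s
    rwa [Nat.card_eq_fintype_card, Fintype.card_subtype] at this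
  have hsumA : ∑ s, A s = (p ^ m) ^ 2 - 1 := by
    have h1 := Finset.card_eq_sum_card_fiberwise (s := Finset.univ.filter fun x : F => x ≠ 0)
      (t := Finset.univ) (f := fun x => Algebra.trace (ZMod p) F (a * x + b * x⁻¹))
      (fun x _ => Finset.mem_coe.2 (Finset.mem_univ _))
    rw [Finset.filter_ne' Finset.univ (0 : F), Finset.card_erase_of_mem (Finset.mem_univ _),
      Finset.card_univ, hcard, ← Finset.filter_ne'] at h1
    rw [h1]
    refine Finset.sum_congr rfl fun s _ => ?_
    rw [hA, Finset.filter_filter]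
  have hsum : (∑ x : F, if x = 0 then 0 else
      ψ (Algebra.trace (ZMod p) F (a * x + b * x⁻¹))) = ∑ s, (A s : ℂ) * ψ s := by
    rw [← Finset.sum_fiberwise_of_maps_to (t := Finset.univ)
      (g := fun x => Algebra.trace (ZMod p) F (a * x + b * x⁻¹)) (fun x _ => Finset.mem_univ _)]
    refine Finset.sum_congr rfl fun s _ => ?_
    rw [← nsmul_eq_mul, ← Finset.sum_const, ← Finset.filter_filter, Finset.filter_comm,
      Finset.sum_filter (fun x : F => x ≠ 0)]
    refine Finset.sum_congr rfl fun x hx => ?_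
    rw [(Finset.mem_filter.1 hx).2]
    split_ifs <;> simp_all
  set e : ZMod p → ℝ := fun s => (p : ℝ) ^ (2 * m) / p + 15 * p ^ m - A s with he
  have he0 : ∀ s, 0 ≤ e s := by
    intro s
    have h1 : (p : ℝ) * A s ≤ (p ^ m) ^ 2 + 15 * p * p ^ m := by exact_mod_cast hAle s
    have h2 : (A s : ℝ) ≤ (p : ℝ) ^ (2 * m) / p + 15 * p ^ m := by
      rw [← mul_le_mul_iff_right₀ hp0]
      refine h1.trans_eq ?_
      field_simp
      ring
    simp only [he]
    linarith
  have hsume : ∑ s, e s = 15 * p * p ^ m + 1 := by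
    have h1 : ((∑ s, A s : ℕ) : ℝ) = (p ^ m) ^ 2 - 1 := by
      rw [hsumA, Nat.cast_sub (Nat.one_le_pow _ _ (pow_pos (Fact.out : p.Prime).pos m))]
      push_cast
      rfl
    push_cast at h1
    simp only [he, Finset.sum_sub_distrib, h1, Finset.sum_const, Finset.card_univ, ZMod.card,
      nsmul_eq_mul]
    field_simp
    ring
  have hψ0 : ∑ s, ψ s = 0 := AddChar.sum_eq_zero_of_ne_one hψ
  have hneg : ∑ s, (A s : ℂ) * ψ s = -∑ s, (e s : ℂ) * ψ s := by
    have : ∀ s, (A s : ℂ) * ψ s =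
        ((p : ℂ) ^ (2 * m) / p + 15 * p ^ m) * ψ s - (e s : ℂ) * ψ s := by
      intro s
      simp only [he]
      push_cast
      ring
    rw [Finset.sum_congr rfl fun s _ => this s, Finset.sum_sub_distrib, ← Finset.mul_sum, hψ0]
    ring
  rw [hsum, hneg, norm_neg]
  calc ‖∑ s, (e s : ℂ) * ψ s‖ ≤ ∑ s, ‖(e s : ℂ) * ψ s‖ := norm_sum_le _ _
    _ = ∑ s, e s := by
        refine Finset.sum_congr rfl fun s _ => ?_
        rw [norm_mul, AddChar.norm_apply, mul_one, Complex.norm_real, Real.norm_of_nonneg (he0 s)]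
    _ = 15 * p * p ^ m + 1 := hsume
    _ ≤ 16 * p * (p : ℝ) ^ m := by
        have : 1 * 1 ≤ p * (p : ℝ) ^ m :=
          mul_le_mul hp1 (one_le_pow₀ hp1) zero_le_one hp0.le
        linarith

theorem sum_ite_eq_zero_eq_sum_units {K : Type*} [Field K] [Fintype K] [DecidableEq K]
    (f : K → ℂ) : (∑ x : K, if x = 0 then 0 else f x) = ∑ u : Kˣ, f u := by
  rw [← Fintype.sum_equiv unitsEquivNeZero.symm (fun x : {x : K // x ≠ 0} => f x) _
    (fun x => by simp [unitsEquivNeZero]),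
    ← Finset.sum_subtype (Finset.univ.filter fun x : K => x ≠ 0)
    (by simp) f, Finset.sum_filter]
  refine Finset.sum_congr rfl fun x _ => ?_
  split_ifs <;> simp_all

/-- Weil's bound for Kloosterman sums to an odd prime modulus. -/
theorem norm_sum_addChar_zmod_prime_le {p : ℕ} [Fact p.Prime] (hp : p ≠ 2)
    {ψ : AddChar (ZMod p) ℂ} (hψ : ψ ≠ 1) {a b : ZMod p} (ha : a ≠ 0) (hb : b ≠ 0) :
    ‖∑ u : (ZMod p)ˣ, ψ (a * u + b * (u⁻¹ : (ZMod p)ˣ))‖ ≤ 2 * √p := by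
  classical
  obtain ⟨α, β, hsum, hmul, hlift⟩ := exists_add_pow_eq_neg_sum_trace hψ ha hb
  have hprime : p.Prime := Fact.out
  have hp0 : (0 : ℝ) < p := by exact_mod_cast hprime.pos
  rw [ZMod.card] at hmul
  have hgrow : ∀ m, 100 * p ≤ m → ‖α ^ (2 * m) + β ^ (2 * m)‖ ≤ 16 * p * (p : ℝ) ^ m := by
    intro m hm
    have hm0 : 2 * m ≠ 0 := by have := hprime.pos; omega
    let : Fintype (GaloisField p (2 * m)) := Fintype.ofFinite _
    have h1 := hlift (GaloisField p (2 * m))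
    rw [GaloisField.finrank p hm0] at h1
    rw [← norm_neg, ← h1]
    refine norm_sum_addChar_trace_le hp ?_ (hm.trans (Nat.lt_pow_self hprime.one_lt).le)
      ?_ ?_ hψ
    · rw [← Nat.card_eq_fintype_card, GaloisField.card p _ hm0, mul_comm, pow_mul]
    · simpa using ha
    · simpa using hb
  have hnmul : ‖α‖ * ‖β‖ = p := by rw [← norm_mul, hmul, Complex.norm_natCast]
  have hα := Real.le_sqrt_of_sq_le (norm_sq_le_of_norm_add_pow_le hp0 hnmul hgrow)
  have hβ := Real.le_sqrt_of_sq_le (norm_sq_le_of_norm_add_pow_le hp0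
    ((mul_comm _ _).trans hnmul) (by simpa only [add_comm] using hgrow))
  have hunits : ∑ u : (ZMod p)ˣ, ψ (a * u + b * (u⁻¹ : (ZMod p)ˣ)) = -(α + β) := by
    rw [← hsum]
    convert (sum_ite_eq_zero_eq_sum_units fun x : ZMod p => ψ (a * x + b * x⁻¹)).symm
    exact Units.val_inv_eq_inv_val _
  rw [hunits, norm_neg]
  exact (norm_add_le α β).trans (by linarith)

end Prime

section Averaging

variable {R : Type*} [CommRing R] [Fintype R]

theorem sum_addChar_mul_eq_ite {ψ : AddChar R ℂ} (hψ : ψ.IsPrimitive) (c : R) :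
    ∑ t : R, ψ (t * c) = open Classical in if c = 0 then (Fintype.card R : ℂ) else 0 := by
  classical
  simpa using AddChar.sum_mulShift c hψ

theorem norm_sq_sum_addChar_quadratic_le {ψ : AddChar R ℂ} (hψ : ψ.IsPrimitive) (X Y : R) :
    ‖∑ s : R, ψ (s * X + s ^ 2 * Y)‖ ^ 2 ≤
      Fintype.card R * (open Classical in Finset.univ.filter fun h : R => 2 * h * Y = 0).card := by
  classical
  set G := ∑ s : R, ψ (s * X + s ^ 2 * Y) with hG
  have h1 : G * (starRingEnd ℂ) G =
      ∑ h ∈ Finset.univ.filter (fun h : R => 2 * h * Y = 0),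
        (Fintype.card R : ℂ) * ψ (h * X + h ^ 2 * Y) := by
    calc G * (starRingEnd ℂ) G
        = ∑ s : R, ∑ h : R, ψ ((h + s) * X + (h + s) ^ 2 * Y) * ψ (-(s * X + s ^ 2 * Y)) := by
          rw [hG, map_sum, Finset.mul_sum]
          refine Finset.sum_congr rfl fun s _ => ?_
          rw [← Equiv.sum_comp (Equiv.addRight s), Finset.sum_mul]
          refine Finset.sum_congr rfl fun h _ => ?_
          rw [AddChar.map_neg_eq_conj, Equiv.coe_addRight]
      _ = ∑ h : R, ψ (h * X + h ^ 2 * Y) * ∑ s : R, ψ (s * (2 * h * Y)) := by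
          rw [Finset.sum_comm]
          refine Finset.sum_congr rfl fun h _ => ?_
          rw [Finset.mul_sum]
          refine Finset.sum_congr rfl fun s _ => ?_
          rw [← AddChar.map_add_eq_mul, ← AddChar.map_add_eq_mul]
          congr 1
          ring
      _ = _ := by
          rw [Finset.sum_filter]
          refine Finset.sum_congr rfl fun h _ => ?_
          rw [sum_addChar_mul_eq_ite hψ]
          split_ifs <;> ring
  have h2 : ‖G‖ ^ 2 = ‖G * (starRingEnd ℂ) G‖ := by
    rw [norm_mul, RCLike.norm_conj, sq]
  rw [h2, h1]
  refine (norm_sum_le _ _).trans ?_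
  simp only [norm_mul, AddChar.norm_apply, mul_one, Complex.norm_natCast, Finset.sum_const,
    nsmul_eq_mul]
  rw [mul_comm]

variable [Fintype Rˣ]

/-- Averaging a Kloosterman sum over the units `1 + z t`, where `z ^ 2 = 0`. -/
theorem sum_units_addChar_eq_sum_filter {ψ : AddChar R ℂ} (hψ : ψ.IsPrimitive) (m n : R) {z : R}
    (hz : z ^ 2 = 0) :
    ∑ u : Rˣ, ψ (m * u + n * (u⁻¹ : Rˣ)) =
      ∑ u ∈ (open Classical in Finset.univ.filter fun u : Rˣ => z * (m * u - n * (u⁻¹ : Rˣ)) = 0),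
        ψ (m * u + n * (u⁻¹ : Rˣ)) := by
  classical
  have hR : (Fintype.card R : ℂ) ≠ 0 := by simp
  have hshift : ∀ t : R, ∑ u : Rˣ, ψ (m * u + n * (u⁻¹ : Rˣ)) =
      ∑ u : Rˣ, ψ (m * u + n * (u⁻¹ : Rˣ)) * ψ (t * (z * (m * u - n * (u⁻¹ : Rˣ)))) := by
    intro t
    let v : Rˣ := ⟨1 + z * t, 1 - z * t, by linear_combination -t ^ 2 * hz,
      by linear_combination -t ^ 2 * hz⟩
    have hv : ((v⁻¹ : Rˣ) : R) = 1 - z * t := rfl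
    have hv' : (v : R) = 1 + z * t := rfl
    rw [← Equiv.sum_comp (Equiv.mulRight v)]
    refine Finset.sum_congr rfl fun u _ => ?_
    rw [← AddChar.map_add_eq_mul, Equiv.coe_mulRight, mul_inv_rev, Units.val_mul, Units.val_mul,
      hv, hv']
    congr 1
    ring
  refine mul_left_cancel₀ hR ?_
  calc (Fintype.card R : ℂ) * ∑ u : Rˣ, ψ (m * u + n * (u⁻¹ : Rˣ))
      = ∑ _t : R, ∑ u : Rˣ, ψ (m * u + n * (u⁻¹ : Rˣ)) := by simp
    _ = ∑ u : Rˣ, ∑ t : R, ψ (m * u + n * (u⁻¹ : Rˣ)) *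
          ψ (t * (z * (m * u - n * (u⁻¹ : Rˣ)))) := by
        rw [Finset.sum_congr rfl fun t _ => hshift t, Finset.sum_comm]
    _ = _ := by
        rw [Finset.mul_sum, Finset.sum_filter]
        refine Finset.sum_congr rfl fun u _ => ?_
        rw [← Finset.mul_sum, sum_addChar_mul_eq_ite hψ]
        split_ifs <;> ring

/-- Averaging the sum over the critical points a second time, over the units `1 + w s` where
`w ^ 3 = 0`; the inner sums are quadratic Gauss sums. -/
theorem norm_sum_filter_addChar_le {ψ : AddChar R ℂ} (hψ : ψ.IsPrimitive) (m n : R)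
    {z w : R} (hw : w ^ 3 = 0) (hzw : z * w = 0) {B : ℝ}
    (hB : ∀ u : Rˣ, ((open Classical in Finset.univ.filter fun h : R =>
      2 * h * (w ^ 2 * (n * (u⁻¹ : Rˣ))) = 0).card : ℝ) * B ^ 2 ≤ Fintype.card R)
    (hB0 : 0 < B) :
    ‖∑ u ∈ (open Classical in Finset.univ.filter fun u : Rˣ => z * (m * u - n * (u⁻¹ : Rˣ)) = 0),
      ψ (m * u + n * (u⁻¹ : Rˣ))‖ * B ≤
      (open Classical in Finset.univ.filter
        fun u : Rˣ => z * (m * u - n * (u⁻¹ : Rˣ)) = 0).card := by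
  classical
  set E := Finset.univ.filter fun u : Rˣ => z * (m * u - n * (u⁻¹ : Rˣ)) = 0 with hE
  have hR : 0 < (Fintype.card R : ℝ) := by exact_mod_cast Fintype.card_pos
  have hshift : ∀ s : R, ∑ u ∈ E, ψ (m * u + n * (u⁻¹ : Rˣ)) =
      ∑ u ∈ E, ψ (m * u + n * (u⁻¹ : Rˣ)) * ψ (s * (w * (m * u - n * (u⁻¹ : Rˣ))) +
        s ^ 2 * (w ^ 2 * (n * (u⁻¹ : Rˣ)))) := by
    intro s
    let v : Rˣ := ⟨1 + w * s, 1 - w * s + w ^ 2 * s ^ 2, by linear_combination s ^ 3 * hw,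
      by linear_combination s ^ 3 * hw⟩
    have hv : ((v⁻¹ : Rˣ) : R) = 1 - w * s + w ^ 2 * s ^ 2 := rfl
    have hv' : (v : R) = 1 + w * s := rfl
    symm
    refine Finset.sum_equiv (Equiv.mulRight v) ?_ ?_
    · intro u
      simp only [hE, Finset.mem_filter, Finset.mem_univ, true_and, Equiv.coe_mulRight, mul_inv_rev,
        Units.val_mul, hv, hv']
      have : z * (m * (u * (1 + w * s)) - n * ((1 - w * s + w ^ 2 * s ^ 2) * (u⁻¹ : Rˣ))) =
          z * (m * u - n * (u⁻¹ : Rˣ)) := by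
        linear_combination (m * u * s - n * (u⁻¹ : Rˣ) * (-s + w * s ^ 2)) * hzw
      rw [this]
    · intro u _
      rw [← AddChar.map_add_eq_mul, Equiv.coe_mulRight, mul_inv_rev, Units.val_mul, Units.val_mul,
        hv, hv']
      congr 1
      ring
  have hGauss : ∀ u : Rˣ, ‖∑ s : R, ψ (s * (w * (m * u - n * (u⁻¹ : Rˣ))) +
      s ^ 2 * (w ^ 2 * (n * (u⁻¹ : Rˣ))))‖ * B ≤ Fintype.card R := by
    intro u
    refine abs_le_of_sq_le_sq' ?_ hR.le |>.2
    rw [mul_pow]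
    calc _ ≤ (Fintype.card R : ℝ) * _ * B ^ 2 := by
          gcongr
          exact norm_sq_sum_addChar_quadratic_le hψ _ _
      _ ≤ _ := by
          rw [mul_assoc, sq (Fintype.card R : ℝ)]
          exact mul_le_mul_of_nonneg_left (hB u) hR.le
  have hmain : (Fintype.card R : ℂ) * ∑ u ∈ E, ψ (m * u + n * (u⁻¹ : Rˣ)) =
      ∑ u ∈ E, ψ (m * u + n * (u⁻¹ : Rˣ)) *
        ∑ s : R, ψ (s * (w * (m * u - n * (u⁻¹ : Rˣ))) +
          s ^ 2 * (w ^ 2 * (n * (u⁻¹ : Rˣ)))) := by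
    calc _ = ∑ _s : R, ∑ u ∈ E, ψ (m * u + n * (u⁻¹ : Rˣ)) := by simp
      _ = _ := by
        rw [Finset.sum_congr rfl fun s _ => hshift s, Finset.sum_comm]
        simp only [Finset.mul_sum]
  have hnorm := congrArg norm hmain
  rw [norm_mul, Complex.norm_natCast] at hnorm
  rw [← mul_le_mul_iff_right₀ hR, ← mul_assoc, hnorm]
  calc _ ≤ (∑ u ∈ E, ‖ψ (m * u + n * (u⁻¹ : Rˣ)) *
        ∑ s : R, ψ (s * (w * (m * u - n * (u⁻¹ : Rˣ))) +
          s ^ 2 * (w ^ 2 * (n * (u⁻¹ : Rˣ))))‖) * B := by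
        gcongr
        exact norm_sum_le _ _
    _ ≤ ∑ u ∈ E, (Fintype.card R : ℝ) := by
        rw [Finset.sum_mul]
        refine Finset.sum_le_sum fun u _ => ?_
        rw [norm_mul, AddChar.norm_apply, one_mul]
        exact hGauss u
    _ = _ := by
        rw [Finset.sum_const, nsmul_eq_mul, mul_comm]

end Averaging

section PrimePower

theorem ZMod.natCast_dvd_or_isUnit {p k : ℕ} (hp : p.Prime) (hk : 0 < k) (x : ZMod (p ^ k)) :
    (p : ZMod (p ^ k)) ∣ x ∨ IsUnit x := by
  have : NeZero (p ^ k) := ⟨(pow_pos hp.pos k).ne'⟩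
  rw [← ZMod.natCast_zmod_val x, ZMod.isUnit_natCast_iff_not_dvd_pow hp hk]
  by_cases h : p ∣ x.val
  · exact Or.inl (Nat.cast_dvd_cast h)
  · exact Or.inr h

theorem ZMod.card_filter_natCast_mul_eq_zero_le {N : ℕ} [NeZero N] {d : ℕ} (hd : 0 < d) :
    (Finset.univ.filter fun x : ZMod N => (d : ZMod N) * x = 0).card ≤ d := by
  classical
  have := IsAddCyclic.card_nsmul_eq_zero_le (α := ZMod N) hd
  simpa only [nsmul_eq_mul] using this

/-- The critical points of a Kloosterman sum to a prime power modulus. -/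
theorem card_filter_critical_le {p k : ℕ} (hp : p.Prime) (hk : 0 < k) [NeZero (p ^ k)]
    {m n z : ZMod (p ^ k)} (hm : IsUnit m) {d : ℕ} (hd : 0 < d)
    (hdz : ∀ x : ZMod (p ^ k), 2 * z * x = 0 → (d : ZMod (p ^ k)) * x = 0) :
    (Finset.univ.filter fun u : (ZMod (p ^ k))ˣ =>
      z * (m * u - n * (u⁻¹ : (ZMod (p ^ k))ˣ)) = 0).card ≤ 2 * d := by
  classical
  set E := Finset.univ.filter fun u : (ZMod (p ^ k))ˣ =>
    z * (m * u - n * (u⁻¹ : (ZMod (p ^ k))ˣ)) = 0 with hE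
  obtain hemp | ⟨u₀, hu₀⟩ := E.eq_empty_or_nonempty
  · rw [hemp]
    simp
  set S := Finset.univ.filter fun x : ZMod (p ^ k) => (d : ZMod (p ^ k)) * x = 0 with hS
  have hSd : S.card ≤ d := ZMod.card_filter_natCast_mul_eq_zero_le hd
  have hnot : ¬ IsUnit (p : ZMod (p ^ k)) := by
    rw [ZMod.isUnit_natCast_iff_not_dvd_pow hp hk]
    simp
  have hcrit : ∀ u ∈ E, z * (m * u ^ 2 - n) = 0 := by
    intro u hu
    have h1 := (Finset.mem_filter.1 hu).2
    have h2 : (u : ZMod (p ^ k)) * (u⁻¹ : (ZMod (p ^ k))ˣ) = 1 := u.mul_inv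
    linear_combination u * h1 + z * n * h2
  have hhalf : ∀ u : (ZMod (p ^ k))ˣ, ∃ x : ZMod (p ^ k), (u : ZMod (p ^ k)) - u₀ = 2 * x := by
    intro u
    rcases eq_or_ne p 2 with rfl | hp2
    · have key : ∀ v : (ZMod (2 ^ k))ˣ, ∃ y : ZMod (2 ^ k), (v : ZMod (2 ^ k)) = 2 * y + 1 := by
        intro v
        have h1 : ¬ 2 ∣ (v : ZMod (2 ^ k)).val := by
          rw [← ZMod.isUnit_natCast_iff_not_dvd_pow hp hk, ZMod.natCast_zmod_val]
          exact v.isUnit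
        refine ⟨((v : ZMod (2 ^ k)).val / 2 : ℕ), ?_⟩
        conv_lhs => rw [← ZMod.natCast_zmod_val (v : ZMod (2 ^ k)),
          show (v : ZMod (2 ^ k)).val = 2 * ((v : ZMod (2 ^ k)).val / 2) + 1 by omega]
        push_cast
        ring
      obtain ⟨y, hy⟩ := key u
      obtain ⟨y', hy'⟩ := key u₀
      exact ⟨y - y', by rw [hy, hy']; ring⟩
    · have h2 : IsUnit (2 : ZMod (p ^ k)) := by
        have := (ZMod.isUnit_natCast_iff_not_dvd_pow (a := 2) hp hk).2
          (fun h => hp2 ((Nat.prime_dvd_prime_iff_eq hp Nat.prime_two).1 h))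
        exact_mod_cast this
      exact h2.dvd
  have hmem : ∀ u ∈ E, (u : ZMod (p ^ k)) ∈ S.image (· + (u₀ : ZMod (p ^ k))) ∪
      S.image (· - (u₀ : ZMod (p ^ k))) := by
    intro u hu
    obtain ⟨x, hx⟩ := hhalf u
    have h1 : z * ((u - u₀) * (u + u₀)) = 0 := by
      refine hm.mul_left_cancel ?_
      linear_combination hcrit u hu - hcrit u₀ hu₀
    have h2 : (u : ZMod (p ^ k)) + u₀ = 2 * (x + u₀) := by linear_combination hx
    rw [Finset.mem_union, Finset.mem_image, Finset.mem_image]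
    have hunit : IsUnit x ∨ IsUnit (x + u₀) := by
      rcases ZMod.natCast_dvd_or_isUnit hp hk x with ⟨y, hy⟩ | hxu
      · rcases ZMod.natCast_dvd_or_isUnit hp hk (x + u₀) with ⟨y', hy'⟩ | hxu
        · refine absurd (isUnit_of_dvd_unit ⟨y' - y, ?_⟩ u₀.isUnit) hnot
          linear_combination hy' - hy
        · exact Or.inr hxu
      · exact Or.inl hxu
    rcases hunit with hxu | hxu
    · right
      refine ⟨u + u₀, Finset.mem_filter.2 ⟨Finset.mem_univ _, hdz _ ?_⟩, by ring⟩
      refine hxu.mul_left_cancel ?_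
      linear_combination h1 - z * (u + u₀) * hx
    · left
      refine ⟨u - u₀, Finset.mem_filter.2 ⟨Finset.mem_univ _, hdz _ ?_⟩, by ring⟩
      refine hxu.mul_left_cancel ?_
      linear_combination h1 - z * (u - u₀) * h2
  calc E.card = (E.image fun u : (ZMod (p ^ k))ˣ => (u : ZMod (p ^ k))).card :=
        (Finset.card_image_of_injective _ Units.val_injective).symm
    _ ≤ (S.image (· + (u₀ : ZMod (p ^ k))) ∪ S.image (· - (u₀ : ZMod (p ^ k)))).card := by
        refine Finset.card_le_card fun y hy => ?_
        obtain ⟨u, hu, rfl⟩ := Finset.mem_image.1 hy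
        exact hmem u hu
    _ ≤ S.card + S.card := (Finset.card_union_le _ _).trans
        (add_le_add Finset.card_image_le Finset.card_image_le)
    _ ≤ 2 * d := by omega

theorem ZMod.natCast_pow_ne_zero {p j k : ℕ} (hp : p.Prime) (hjk : j < k) :
    (p : ZMod (p ^ k)) ^ j ≠ 0 := by
  rw [← Nat.cast_pow, Ne, ZMod.natCast_eq_zero_iff, Nat.pow_dvd_pow_iff_le_right hp.one_lt]
  omega

theorem ZMod.natCast_pow_eq_zero {p j k : ℕ} (hjk : k ≤ j) :
    (p : ZMod (p ^ k)) ^ j = 0 := by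
  rw [← Nat.cast_pow, ZMod.natCast_eq_zero_iff]
  exact pow_dvd_pow p hjk

theorem isUnit_of_critical {p k : ℕ} (hp : p.Prime) (hk : 0 < k)
    {m n z : ZMod (p ^ k)} (hmn : IsUnit m ∨ IsUnit n) (hz : z ≠ 0) {u : (ZMod (p ^ k))ˣ}
    (hu : z * (m * u - n * (u⁻¹ : (ZMod (p ^ k))ˣ)) = 0) : IsUnit m ∧ IsUnit n := by
  have hnot := ZMod.prime_natCast_not_isUnit_pow hp hk
  rcases ZMod.natCast_dvd_or_isUnit hp hk (m * u - n * (u⁻¹ : (ZMod (p ^ k))ˣ)) with ⟨y, hy⟩ | h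
  · have h1 : (u : ZMod (p ^ k)) * (u⁻¹ : (ZMod (p ^ k))ˣ) = 1 := u.mul_inv
    constructor
    · refine (ZMod.natCast_dvd_or_isUnit hp hk m).resolve_left ?_
      rintro ⟨x, hx⟩
      rcases hmn with h | h
      · exact hnot (isUnit_of_dvd_unit ⟨x, hx⟩ h)
      · refine hnot (isUnit_of_dvd_unit ⟨u * (x * u - y), ?_⟩ h)
        linear_combination (-u : ZMod (p ^ k)) * hy + u ^ 2 * hx - n * h1
    · refine (ZMod.natCast_dvd_or_isUnit hp hk n).resolve_left ?_
      rintro ⟨x, hx⟩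
      rcases hmn with h | h
      · refine hnot (isUnit_of_dvd_unit
          ⟨(u⁻¹ : (ZMod (p ^ k))ˣ) * (x * (u⁻¹ : (ZMod (p ^ k))ˣ) + y), ?_⟩ h)
        linear_combination ((u⁻¹ : (ZMod (p ^ k))ˣ) : ZMod (p ^ k)) * hy +
          ((u⁻¹ : (ZMod (p ^ k))ˣ) : ZMod (p ^ k)) ^ 2 * hx - m * h1
      · exact hnot (isUnit_of_dvd_unit ⟨x, hx⟩ h)
  · exact absurd (h.mul_left_eq_zero.1 hu) hz

theorem norm_sum_units_addChar_le_two_mul {p k : ℕ} (hp : p.Prime) (hk : 0 < k) [NeZero (p ^ k)]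
    {ψ : AddChar (ZMod (p ^ k)) ℂ} (hψ : ψ.IsPrimitive) {m n z : ZMod (p ^ k)}
    (hmn : IsUnit m ∨ IsUnit n) (hz : z ≠ 0) (hz2 : z ^ 2 = 0) {d : ℕ} (hd : 0 < d)
    (hdz : ∀ x : ZMod (p ^ k), 2 * z * x = 0 → (d : ZMod (p ^ k)) * x = 0) :
    ‖∑ u : (ZMod (p ^ k))ˣ, ψ (m * u + n * (u⁻¹ : (ZMod (p ^ k))ˣ))‖ ≤ 2 * d := by
  classical
  rw [sum_units_addChar_eq_sum_filter hψ m n hz2]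
  refine (norm_sum_le _ _).trans ?_
  simp only [AddChar.norm_apply, Finset.sum_const, nsmul_eq_mul, mul_one]
  by_cases hm : IsUnit m
  · have := card_filter_critical_le (n := n) hp hk hm hd hdz
    have h2 : ((2 * d : ℕ) : ℝ) = 2 * d := by push_cast; rfl
    rw [← h2, Nat.cast_le]
    convert this
  · have hempty : ∀ u : (ZMod (p ^ k))ˣ, ¬ z * (m * u - n * (u⁻¹ : (ZMod (p ^ k))ˣ)) = 0 :=
      fun u hu => hm (isUnit_of_critical hp hk hmn hz hu).1
    simp only [hempty, Finset.filter_false, Finset.card_empty]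
    simp

theorem norm_sum_units_addChar_mul_sqrt_le {p l : ℕ} (hp : p.Prime) (hp2 : p ≠ 2) (hl : 0 < l)
    [NeZero (p ^ (2 * l + 1))]
    {ψ : AddChar (ZMod (p ^ (2 * l + 1))) ℂ} (hψ : ψ.IsPrimitive) {m n : ZMod (p ^ (2 * l + 1))}
    (hmn : IsUnit m ∨ IsUnit n) :
    ‖∑ u : (ZMod (p ^ (2 * l + 1)))ˣ, ψ (m * u + n * (u⁻¹ : (ZMod (p ^ (2 * l + 1)))ˣ))‖ * √p ≤
      2 * p ^ (l + 1) := by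
  classical
  have hp0 : (0 : ℝ) < p := by exact_mod_cast hp.pos
  have hk : 0 < 2 * l + 1 := by omega
  have h2 : IsUnit (2 : ZMod (p ^ (2 * l + 1))) := by
    have := (ZMod.isUnit_natCast_iff_not_dvd_pow (a := 2) hp hk).2
      (fun h => hp2 ((Nat.prime_dvd_prime_iff_eq hp Nat.prime_two).1 h))
    exact_mod_cast this
  set z : ZMod (p ^ (2 * l + 1)) := (p : ZMod (p ^ (2 * l + 1))) ^ (l + 1) with hz
  set w : ZMod (p ^ (2 * l + 1)) := (p : ZMod (p ^ (2 * l + 1))) ^ l with hw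
  have hz0 : z ≠ 0 := ZMod.natCast_pow_ne_zero hp (by omega)
  have hz2 : z ^ 2 = 0 := by
    rw [hz, ← pow_mul]
    exact ZMod.natCast_pow_eq_zero (by omega)
  rw [sum_units_addChar_eq_sum_filter hψ m n hz2]
  by_cases hmu : IsUnit m ∧ IsUnit n
  · have hcard := card_filter_critical_le (n := n) (z := z) (d := p ^ (l + 1)) hp hk hmu.1
      (pow_pos hp.pos _) (fun x hx => by
        rw [mul_assoc] at hx
        have := (IsUnit.mul_right_eq_zero h2).1 hx
        rwa [hz, ← Nat.cast_pow] at this)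
    have hbound := norm_sum_filter_addChar_le hψ m n (z := z) (w := w) (B := √p)
      (by rw [hw, ← pow_mul]; exact ZMod.natCast_pow_eq_zero (by omega))
      (by rw [hz, hw, ← pow_add]; exact ZMod.natCast_pow_eq_zero (by omega))
      (by
        intro u
        rw [Real.sq_sqrt hp0.le, ZMod.card,
          show ((p ^ (2 * l + 1) : ℕ) : ℝ) = (p ^ (2 * l) : ℕ) * p by push_cast; ring]
        refine mul_le_mul_of_nonneg_right ?_ hp0.le
        rw [Nat.cast_le]
        refine le_trans (Finset.card_le_card ?_) (ZMod.card_filter_natCast_mul_eq_zero_le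
          (N := p ^ (2 * l + 1)) (d := p ^ (2 * l)) (pow_pos hp.pos _))
        intro h hh
        simp only [Finset.mem_filter, Finset.mem_univ, true_and] at hh ⊢
        have h3 : 2 * n * (u⁻¹ : (ZMod (p ^ (2 * l + 1)))ˣ) *
            (((p ^ (2 * l) : ℕ) : ZMod (p ^ (2 * l + 1))) * h) = 0 := by
          rw [← hh, hw]
          push_cast
          ring
        exact (IsUnit.mul_right_eq_zero ((h2.mul hmu.2).mul u⁻¹.isUnit)).1 h3)
      (Real.sqrt_pos.2 hp0)
    refine hbound.trans ?_
    have h2 : ((2 * p ^ (l + 1) : ℕ) : ℝ) = 2 * p ^ (l + 1) := by push_cast; rfl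
    rw [← h2, Nat.cast_le]
    convert hcard
  · have hempty : ∀ u : (ZMod (p ^ (2 * l + 1)))ˣ,
        ¬ z * (m * u - n * (u⁻¹ : (ZMod (p ^ (2 * l + 1)))ˣ)) = 0 :=
      fun u hu => hmu (isUnit_of_critical hp hk hmn hz0 hu)
    simp only [hempty, Finset.filter_false, Finset.sum_empty, norm_zero, zero_mul]
    positivity

/-- The bound for Kloosterman sums to a higher power of an odd prime. -/
theorem norm_sum_units_addChar_prime_pow_le {p k : ℕ} (hp : p.Prime) (hp2 : p ≠ 2) (hk : 2 ≤ k)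
    [NeZero (p ^ k)] {ψ : AddChar (ZMod (p ^ k)) ℂ} (hψ : ψ.IsPrimitive) {m n : ZMod (p ^ k)}
    (hmn : IsUnit m ∨ IsUnit n) :
    ‖∑ u : (ZMod (p ^ k))ˣ, ψ (m * u + n * (u⁻¹ : (ZMod (p ^ k))ˣ))‖ ≤ 2 * √(p ^ k) := by
  have hp0 : (0 : ℝ) < p := by exact_mod_cast hp.pos
  obtain ⟨l, rfl | rfl⟩ := Nat.even_or_odd' k
  · have h2 : IsUnit (2 : ZMod (p ^ (2 * l))) := by
      have := (ZMod.isUnit_natCast_iff_not_dvd_pow (a := 2) hp (by omega : 0 < 2 * l)).2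
        (fun h => hp2 ((Nat.prime_dvd_prime_iff_eq hp Nat.prime_two).1 h))
      exact_mod_cast this
    have := norm_sum_units_addChar_le_two_mul hp (by omega) hψ hmn
      (ZMod.natCast_pow_ne_zero hp (by omega : l < 2 * l))
      (by rw [← pow_mul]; exact ZMod.natCast_pow_eq_zero (by omega)) (pow_pos hp.pos l)
      (fun x hx => by
        rw [mul_assoc] at hx
        have := (IsUnit.mul_right_eq_zero h2).1 hx
        rwa [← Nat.cast_pow] at this)
    refine this.trans_eq ?_
    rw [mul_comm 2 l, pow_mul, Real.sqrt_sq (by positivity)]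
    push_cast
    rfl
  · have := norm_sum_units_addChar_mul_sqrt_le hp hp2 (by omega) hψ hmn
    rw [← mul_le_mul_iff_left₀ (Real.sqrt_pos.2 hp0)]
    refine this.trans_eq ?_
    rw [mul_assoc, ← Real.sqrt_mul (by positivity),
      show (p : ℝ) ^ (2 * l + 1) * p = (p ^ (l + 1)) ^ 2 by ring, Real.sqrt_sq (by positivity)]

/-- The bound for Kloosterman sums to a power of two. -/
theorem norm_sum_units_addChar_two_pow_le {k : ℕ} (hk : 4 ≤ k)
    [NeZero (2 ^ k)] {ψ : AddChar (ZMod (2 ^ k)) ℂ} (hψ : ψ.IsPrimitive) {m n : ZMod (2 ^ k)}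
    (hmn : IsUnit m ∨ IsUnit n) :
    ‖∑ u : (ZMod (2 ^ k))ˣ, ψ (m * u + n * (u⁻¹ : (ZMod (2 ^ k))ˣ))‖ ≤ (k + 1) * √(2 ^ k) := by
  have main : ∀ l, l < k → k ≤ 2 * l →
      ‖∑ u : (ZMod (2 ^ k))ˣ, ψ (m * u + n * (u⁻¹ : (ZMod (2 ^ k))ˣ))‖ ≤ 4 * 2 ^ l := by
    intro l hlk hkl
    have := norm_sum_units_addChar_le_two_mul Nat.prime_two (by omega) hψ hmn
      (z := ((2 : ℕ) : ZMod (2 ^ k)) ^ l) (ZMod.natCast_pow_ne_zero Nat.prime_two hlk)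
      (by rw [← pow_mul]; exact ZMod.natCast_pow_eq_zero (by omega)) (d := 2 ^ (l + 1))
      (by positivity) (fun x hx => by rw [← hx]; push_cast; ring)
    refine this.trans_eq ?_
    push_cast
    ring
  obtain ⟨l, rfl | rfl⟩ := Nat.even_or_odd' k
  · refine (main l (by omega) le_rfl).trans ?_
    rw [mul_comm 2 l, pow_mul, Real.sqrt_sq (by positivity)]
    have : (2 : ℝ) ≤ l := by exact_mod_cast (by omega : 2 ≤ l)
    gcongr
    push_cast
    linarith
  · refine (main (l + 1) (by omega) (by omega)).trans ?_
    rw [pow_succ 2 (2 * l), mul_comm 2 l, pow_mul, Real.sqrt_mul (by positivity),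
      Real.sqrt_sq (by positivity), pow_succ]
    have hl : (2 : ℝ) ≤ l := by exact_mod_cast (by omega : 2 ≤ l)
    have h2 : (1.4 : ℝ) ≤ √2 := Real.le_sqrt_of_sq_le (by norm_num)
    have h3 : (8 : ℝ) ≤ (2 * l + 2) * √2 := by nlinarith
    push_cast
    have h4 : (0 : ℝ) < 2 ^ l := by positivity
    nlinarith

end PrimePower

section Modulus

/-- The Kloosterman sum as a sum over the units of `ZMod N`. -/
noncomputable def kloostermanUnits (N : ℕ) [NeZero N] (m n : ℤ) : ℂ :=
  ∑ u : (ZMod N)ˣ, ZMod.stdAddChar (N := N) (m * u + n * (u⁻¹ : (ZMod N)ˣ))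

theorem norm_kloostermanUnits_le_totient (N : ℕ) [NeZero N] (m n : ℤ) :
    ‖kloostermanUnits N m n‖ ≤ N.totient := by
  refine (norm_sum_le _ _).trans_eq ?_
  simp [AddChar.norm_apply, ZMod.card_units_eq_totient]

theorem norm_sum_units_addChar_mul_eq_one {p : ℕ} [Fact p.Prime] {ψ : AddChar (ZMod p) ℂ}
    (hψ : ψ ≠ 1) {a : ZMod p} (ha : a ≠ 0) : ‖∑ u : (ZMod p)ˣ, ψ (a * u)‖ = 1 := by
  have h1 := sum_ite_eq_zero_eq_sum_units fun x : ZMod p => ψ (a * x)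
  have h2 : ∀ x : ZMod p,
      (if x = 0 then 0 else ψ (a * x)) = ψ (a * x) - if x = 0 then 1 else 0 := by
    intro x
    split_ifs with h <;> simp [h]
  simp only [h2, Finset.sum_sub_distrib, sum_addChar_mul_eq_zero hψ ha] at h1
  have h3 : ∑ u : (ZMod p)ˣ, ψ (a * u) = -1 := by
    convert h1.symm using 1
    simp
  rw [h3, norm_neg, norm_one]

theorem norm_kloostermanUnits_odd_prime_le {p : ℕ} [Fact p.Prime] (hp2 : p ≠ 2) {m n : ℤ}
    (hmn : ¬ ((p : ℤ) ∣ m ∧ (p : ℤ) ∣ n)) : ‖kloostermanUnits p m n‖ ≤ 2 * √p := by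
  have hψ : (ZMod.stdAddChar : AddChar (ZMod p) ℂ) ≠ 1 := by
    have := ZMod.isPrimitive_stdAddChar p (one_ne_zero : (1 : ZMod p) ≠ 0)
    rwa [AddChar.mulShift_one] at this
  have h1 : (1 : ℝ) ≤ 2 * √p := by
    have : (1 : ℝ) ≤ √p :=
      Real.one_le_sqrt.2 (by exact_mod_cast (Fact.out : p.Prime).one_le)
    linarith
  rw [← ZMod.intCast_zmod_eq_zero_iff_dvd, ← ZMod.intCast_zmod_eq_zero_iff_dvd] at hmn
  unfold kloostermanUnits
  by_cases hm : (m : ZMod p) = 0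
  · have hn : (n : ZMod p) ≠ 0 := fun h => hmn ⟨hm, h⟩
    simp only [hm, zero_mul, zero_add]
    have h2 := Equiv.sum_comp (Equiv.inv (ZMod p)ˣ)
      fun u : (ZMod p)ˣ => ZMod.stdAddChar (N := p) (n * u)
    simp only [Equiv.inv_apply] at h2
    rw [h2, norm_sum_units_addChar_mul_eq_one hψ hn]
    exact h1
  by_cases hn : (n : ZMod p) = 0
  · simp only [hn, zero_mul, add_zero]
    rw [norm_sum_units_addChar_mul_eq_one hψ hm]
    exact h1
  · exact norm_sum_addChar_zmod_prime_le hp2 hψ hm hn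

theorem norm_kloostermanUnits_prime_pow_le {p k : ℕ} (hp : p.Prime) (hk : 0 < k) {N : ℕ}
    [NeZero N] (hN : N = p ^ k) {m n : ℤ} (hmn : ¬ ((p : ℤ) ∣ m ∧ (p : ℤ) ∣ n)) :
    ‖kloostermanUnits N m n‖ ≤ (k + 1) * √N := by
  have : Fact p.Prime := ⟨hp⟩
  have hunit : ∀ x : ℤ, ¬ (p : ℤ) ∣ x → IsUnit (x : ZMod (p ^ k)) := by
    intro x hx
    rw [ZMod.coe_int_isUnit_iff_isCoprime]
    push_cast
    exact (((Nat.prime_iff_prime_int.1 hp).coprime_iff_not_dvd).2 hx).pow_left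
  have hmn' : IsUnit (m : ZMod (p ^ k)) ∨ IsUnit (n : ZMod (p ^ k)) := by
    by_contra! h
    exact hmn ⟨by_contra fun h' => h.1 (hunit m h'), by_contra fun h' => h.2 (hunit n h')⟩
  rcases eq_or_ne p 2 with rfl | hp2
  · subst hN
    rcases lt_or_ge k 4 with hk4 | hk4
    · refine (norm_kloostermanUnits_le_totient _ m n).trans ?_
      rw [Nat.totient_prime_pow Nat.prime_two hk]
      have h1 : (1 : ℝ) ≤ √(2 ^ k : ℕ) :=
        Real.one_le_sqrt.2 (by exact_mod_cast Nat.one_le_two_pow)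
      have h2 : ((2 ^ (k - 1) * (2 - 1) : ℕ) : ℝ) ≤ k + 1 := by
        have : 2 ^ (k - 1) * (2 - 1) ≤ k + 1 := by interval_cases k <;> norm_num
        exact_mod_cast this
      nlinarith
    · have := norm_sum_units_addChar_two_pow_le hk4 (ZMod.isPrimitive_stdAddChar _) hmn'
      push_cast
      exact this
  · rcases Nat.lt_or_ge k 2 with hk2 | hk2
    · obtain rfl : k = 1 := by omega
      rw [pow_one] at hN
      subst hN
      refine (norm_kloostermanUnits_odd_prime_le hp2 hmn).trans_eq ?_
      norm_num
    · subst hN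
      have := norm_sum_units_addChar_prime_pow_le hp hp2 hk2 (ZMod.isPrimitive_stdAddChar _) hmn'
      push_cast
      refine this.trans ?_
      gcongr
      have : (2 : ℝ) ≤ k := by exact_mod_cast hk2
      linarith

theorem stdAddChar_natCast_mul {d M N : ℕ} [NeZero M] [NeZero N] (hN : N = d * M) (x : ZMod N) :
    ZMod.stdAddChar ((d : ZMod N) * x) =
      ZMod.stdAddChar (ZMod.castHom (⟨d, by rw [hN, mul_comm]⟩ : M ∣ N) (ZMod M) x) := by
  obtain ⟨y, rfl⟩ := ZMod.intCast_surjective x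
  have hM : (M : ℂ) ≠ 0 := by exact_mod_cast NeZero.ne M
  have hd : (d : ℂ) ≠ 0 := by
    rintro h
    rw [Nat.cast_eq_zero] at h
    exact NeZero.ne N (by rw [hN, h, zero_mul])
  rw [map_intCast, show (d : ZMod N) * (y : ZMod N) = ((d * y : ℤ) : ZMod N) by push_cast; rfl,
    ZMod.stdAddChar_coe, ZMod.stdAddChar_coe, hN]
  congr 1
  push_cast
  field_simp

theorem card_mul_sum_comp_eq_card_mul_sum {G H : Type*} [Group G] [Group H] [Fintype G]
    [Fintype H] {f : G →* H} (hf : Function.Surjective f) (F : H → ℂ) :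
    Fintype.card H * ∑ g, F (f g) = Fintype.card G * ∑ h, F h := by
  have hshift : ∀ h : H, ∑ g, F (f g) = ∑ g, F (f g * h) := by
    intro h
    obtain ⟨g', rfl⟩ := hf h
    rw [← Equiv.sum_comp (Equiv.mulRight g')]
    simp
  calc (Fintype.card H : ℂ) * ∑ g, F (f g) = ∑ _h : H, ∑ g, F (f g) := by simp
    _ = ∑ g, ∑ h, F (f g * h) := by
      rw [Finset.sum_congr rfl fun h _ => hshift h, Finset.sum_comm]
    _ = ∑ _g : G, ∑ h, F h := by
      refine Finset.sum_congr rfl fun g _ => ?_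
      exact Equiv.sum_comp (Equiv.mulLeft (f g)) F
    _ = _ := by simp

theorem kloostermanUnits_prime_pow_mul {p e j : ℕ} (hp : p.Prime) (hj : 0 < j) {M N : ℕ}
    [NeZero M] [NeZero N] (hM : M = p ^ j) (hN : N = p ^ e * M) (m n : ℤ) :
    kloostermanUnits N ((p ^ e : ℕ) * m) ((p ^ e : ℕ) * n) =
      (p ^ e : ℕ) * kloostermanUnits M m n := by
  have hdvd : M ∣ N := ⟨p ^ e, by rw [hN, mul_comm]⟩
  have h1 : kloostermanUnits N ((p ^ e : ℕ) * m) ((p ^ e : ℕ) * n) =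
      ∑ u : (ZMod N)ˣ, ZMod.stdAddChar (N := M) (m * (ZMod.unitsMap hdvd u : (ZMod M)ˣ) +
        n * ((ZMod.unitsMap hdvd u)⁻¹ : (ZMod M)ˣ)) := by
    refine Finset.sum_congr rfl fun u _ => ?_
    have h2 := stdAddChar_natCast_mul hN
      (m * u + n * (u⁻¹ : (ZMod N)ˣ))
    simp only [map_add, map_mul, map_intCast] at h2
    rw [← map_inv]
    refine Eq.trans ?_ (h2.trans ?_)
    · congr 1
      push_cast
      ring
    · rfl
  have h2 := card_mul_sum_comp_eq_card_mul_sum (ZMod.unitsMap_surjective hdvd)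
    fun v : (ZMod M)ˣ => ZMod.stdAddChar (N := M) (m * v + n * (v⁻¹ : (ZMod M)ˣ))
  rw [← h1, ZMod.card_units_eq_totient, ZMod.card_units_eq_totient] at h2
  have htot : N.totient = M.totient * p ^ e := by
    rw [hN, hM, ← pow_add, Nat.totient_prime_pow hp (by omega), Nat.totient_prime_pow hp hj,
      show e + j - 1 = (j - 1) + e by omega, pow_add]
    ring
  have hMt : (M.totient : ℂ) ≠ 0 := by
    exact_mod_cast (Nat.totient_pos.2 (Nat.pos_of_ne_zero (NeZero.ne M))).ne'
  refine mul_left_cancel₀ hMt (h2.trans ?_)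
  rw [htot]
  push_cast
  rw [kloostermanUnits]
  ring

end Modulus

theorem norm_kloostermanUnits_prime_pow_le_sqrt_gcd {p k : ℕ} (hp : p.Prime) {N : ℕ}
    [NeZero N] (hN : N = p ^ k) (m n : ℤ) :
    ‖kloostermanUnits N m n‖ ≤ N.divisors.card * √(Int.gcd m (Int.gcd n N)) * √N := by
  have hcard : N.divisors.card = k + 1 := by
    rw [hN, Nat.divisors_prime_pow hp, Finset.card_map, Finset.card_range]
  rw [hcard]
  obtain ⟨e, hek, he⟩ : ∃ e ≤ k, Int.gcd m (Int.gcd n N) = p ^ e := by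
    refine (Nat.dvd_prime_pow hp).1 (hN ▸ ?_)
    have h1 : ((Int.gcd m (Int.gcd n N) : ℕ) : ℤ) ∣ N :=
      (Int.gcd_dvd_right _ _).trans (Int.gcd_dvd_right _ _)
    exact_mod_cast h1
  have hm : ((p ^ e : ℕ) : ℤ) ∣ m := he ▸ Int.gcd_dvd_left _ _
  have hn : ((p ^ e : ℕ) : ℤ) ∣ n := he ▸ (Int.gcd_dvd_right _ _).trans (Int.gcd_dvd_left _ _)
  rw [he]
  rcases hek.eq_or_lt with rfl | hek
  · rw [← hN, mul_assoc, Real.mul_self_sqrt (Nat.cast_nonneg N)]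
    have h1 := norm_kloostermanUnits_le_totient N m n
    have h2 : (N.totient : ℝ) ≤ N := by exact_mod_cast Nat.totient_le N
    have h3 : (0 : ℝ) ≤ (e : ℝ) * N := by positivity
    push_cast
    linarith
  obtain ⟨m', rfl⟩ := hm
  obtain ⟨n', rfl⟩ := hn
  have hpos : 0 < p := hp.pos
  obtain ⟨j, rfl⟩ := Nat.exists_eq_add_of_lt hek
  have hN' : N = p ^ e * p ^ (j + 1) := by rw [hN, ← pow_add, add_assoc]
  have : NeZero (p ^ (j + 1)) := ⟨(pow_pos hpos _).ne'⟩
  rw [kloostermanUnits_prime_pow_mul hp j.succ_pos rfl hN', norm_mul]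
  have hmn : ¬ ((p : ℤ) ∣ m' ∧ (p : ℤ) ∣ n') := by
    rintro ⟨⟨a, rfl⟩, ⟨b, rfl⟩⟩
    have h1 : ((p ^ (e + 1) : ℕ) : ℤ) ∣ ((p ^ e : ℕ) : ℤ) := by
      rw [← he]
      refine Int.dvd_coe_gcd ⟨a, by push_cast; ring⟩ (Int.dvd_coe_gcd ⟨b, by push_cast; ring⟩ ?_)
      exact_mod_cast (show p ^ (e + 1) ∣ N from ⟨p ^ j, by rw [hN']; ring⟩)
    have h2 : p ^ (e + 1) ∣ p ^ e := by exact_mod_cast h1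
    have := (Nat.pow_dvd_pow_iff_le_right hp.one_lt).1 h2
    omega
  have h1 := norm_kloostermanUnits_prime_pow_le hp j.succ_pos rfl hmn
  have h2 : √(p ^ e : ℕ) * √N = (p ^ e : ℕ) * √(p ^ (j + 1) : ℕ) := by
    rw [hN', Nat.cast_mul, Real.sqrt_mul (Nat.cast_nonneg _), ← mul_assoc,
      Real.mul_self_sqrt (Nat.cast_nonneg _)]
  rw [mul_assoc, h2, Complex.norm_natCast]
  calc ((p ^ e : ℕ) : ℝ) * ‖kloostermanUnits (p ^ (j + 1)) m' n'‖
      ≤ (p ^ e : ℕ) * (((j + 1 : ℕ) + 1) * √(p ^ (j + 1) : ℕ)) := by gcongr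
    _ = ((j + 1 : ℕ) + 1) * ((p ^ e : ℕ) * √(p ^ (j + 1) : ℕ)) := by ring
    _ ≤ _ := by
      gcongr
      push_cast
      have : (0 : ℝ) ≤ e := Nat.cast_nonneg e
      linarith

theorem stdAddChar_intCast_mul_eq {M N : ℕ} [NeZero M] [NeZero N] [NeZero (M * N)] {s t : ℤ}
    (hst : t * N + s * M = 1) (x : ℤ) :
    ZMod.stdAddChar (x : ZMod (M * N)) =
      ZMod.stdAddChar ((t * x : ℤ) : ZMod M) * ZMod.stdAddChar ((s * x : ℤ) : ZMod N) := by
  have hM : (M : ℂ) ≠ 0 := by exact_mod_cast NeZero.ne M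
  have hN : (N : ℂ) ≠ 0 := by exact_mod_cast NeZero.ne N
  have hst' : (t : ℂ) * N + s * M = 1 := by exact_mod_cast hst
  rw [ZMod.stdAddChar_coe, ZMod.stdAddChar_coe, ZMod.stdAddChar_coe, ← Complex.exp_add]
  congr 1
  push_cast
  field_simp
  linear_combination (-(x : ℂ)) * hst'

theorem kloostermanUnits_mul_of_coprime {M N : ℕ} [NeZero M] [NeZero N] [NeZero (M * N)]
    (hMN : M.Coprime N) {s t : ℤ} (hst : t * N + s * M = 1) (m n : ℤ) :
    kloostermanUnits (M * N) m n =
      kloostermanUnits M (t * m) (t * n) * kloostermanUnits N (s * m) (s * n) := by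
  set φ : (ZMod (M * N))ˣ ≃* (ZMod M)ˣ × (ZMod N)ˣ :=
    (Units.mapEquiv (ZMod.chineseRemainder hMN).toMulEquiv).trans MulEquiv.prodUnits with hφ
  unfold kloostermanUnits
  rw [Finset.sum_mul_sum, ← Fintype.sum_prod_type', ← Equiv.sum_comp φ.toEquiv]
  refine Finset.sum_congr rfl fun u _ => ?_
  obtain ⟨x, hx⟩ := ZMod.intCast_surjective (u : ZMod (M * N))
  obtain ⟨y, hy⟩ := ZMod.intCast_surjective ((u⁻¹ : (ZMod (M * N))ˣ) : ZMod (M * N))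
  have hc : ∀ (v : (ZMod (M * N))ˣ) (z : ℤ), (z : ZMod (M * N)) = v →
      (((φ v).1 : (ZMod M)ˣ) : ZMod M) = z ∧ (((φ v).2 : (ZMod N)ˣ) : ZMod N) = z := by
    intro v z hz
    have h1 : (((φ v).1 : (ZMod M)ˣ) : ZMod M) = (ZMod.chineseRemainder hMN v).1 := rfl
    have h2 : (((φ v).2 : (ZMod N)ˣ) : ZMod N) = (ZMod.chineseRemainder hMN v).2 := rfl
    rw [h1, h2, ← hz, map_intCast]
    exact ⟨rfl, rfl⟩
  have hux := hc u x hx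
  have huy := hc u⁻¹ y hy
  rw [map_inv] at huy
  have key := stdAddChar_intCast_mul_eq hst (m * x + n * y)
  refine Eq.trans ?_ (key.trans ?_)
  · rw [← hx, ← hy]
    push_cast
    rfl
  · congr 2
    · refine Eq.trans ?_ (congrArg₂ (fun a b : ZMod M => ((t * m : ℤ) : ZMod M) * a +
        ((t * n : ℤ) : ZMod M) * b) hux.1 huy.1).symm
      push_cast
      ring
    · refine Eq.trans ?_ (congrArg₂ (fun a b : ZMod N => ((s * m : ℤ) : ZMod N) * a +
        ((s * n : ℤ) : ZMod N) * b) hux.2 huy.2).symm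
      push_cast
      ring

theorem Int.gcd_mul_mul_gcd_of_isCoprime {t N : ℤ} (h : IsCoprime t N) (m n : ℤ) :
    Int.gcd (t * m) (Int.gcd (t * n) N) = Int.gcd m (Int.gcd n N) := by
  have hcop : Int.gcd t N = 1 := Int.isCoprime_iff_gcd_eq_one.1 h
  rw [mul_comm t m, mul_comm t n, Int.gcd_mul_left_left_of_gcd_eq_one hcop]
  refine Int.gcd_mul_left_left_of_gcd_eq_one (Int.isCoprime_iff_gcd_eq_one.1 ?_)
  exact h.of_isCoprime_of_dvd_right (Int.gcd_dvd_right _ _)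

theorem Int.gcd_gcd_mul_of_coprime {M N : ℕ} (h : M.Coprime N) (m n : ℤ) :
    Int.gcd m (Int.gcd n (M * N : ℕ)) =
      Int.gcd m (Int.gcd n M) * Int.gcd m (Int.gcd n N) := by
  simp only [Int.gcd_def, Int.natAbs_natCast]
  rw [← Nat.gcd_assoc, ← Nat.gcd_assoc, ← Nat.gcd_assoc, Nat.Coprime.gcd_mul _ h]

theorem norm_kloostermanUnits_le (N : ℕ) : ∀ [NeZero N] (m n : ℤ),
    ‖kloostermanUnits N m n‖ ≤ N.divisors.card * √(Int.gcd m (Int.gcd n N)) * √N := by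
  induction N using Nat.recOnPosPrimePosCoprime with
  | prime_pow p k hp hk => exact fun m n => norm_kloostermanUnits_prime_pow_le_sqrt_gcd hp rfl m n
  | zero => exact fun {h} => absurd rfl h.out
  | one =>
    exact fun m n =>
      norm_kloostermanUnits_prime_pow_le_sqrt_gcd Nat.prime_two (pow_zero 2).symm m n
  | coprime M N hM hN hMN ihM ihN =>
    intro _ m n
    have : NeZero M := ⟨by omega⟩
    have : NeZero N := ⟨by omega⟩
    obtain ⟨s, t, hst⟩ := Nat.isCoprime_iff_coprime.2 hMN
    have hst' : t * N + s * M = 1 := by rw [add_comm]; exact hst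
    rw [kloostermanUnits_mul_of_coprime hMN hst', norm_mul, hMN.card_divisors_mul,
      Int.gcd_gcd_mul_of_coprime hMN]
    have h1 := ihM (t * m) (t * n)
    have h2 := ihN (s * m) (s * n)
    rw [Int.gcd_mul_mul_gcd_of_isCoprime ⟨N, s, by linarith⟩] at h1
    rw [Int.gcd_mul_mul_gcd_of_isCoprime ⟨M, t, by linarith⟩] at h2
    refine (mul_le_mul h1 h2 (norm_nonneg _) (by positivity)).trans_eq ?_
    push_cast
    rw [Real.sqrt_mul (Nat.cast_nonneg _), Real.sqrt_mul (Nat.cast_nonneg _)]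
    ring

theorem kloostermanSum_eq_kloostermanUnits (m n : ℤ) (c : ℕ) [NeZero c] :
    kloostermanSum m n c = kloostermanUnits c m n := by
  unfold kloostermanSum kloostermanUnits
  symm
  refine Finset.sum_bij (fun u _ => (u : ZMod c).val) ?_ ?_ ?_ ?_
  · intro u _
    rw [Finset.mem_filter, Finset.mem_range]
    exact ⟨ZMod.val_lt _, ZMod.val_coe_unit_coprime u⟩
  · intro u _ v _ h
    exact Units.ext (ZMod.val_injective c h)
  · intro d hd
    rw [Finset.mem_filter, Finset.mem_range] at hd
    exact ⟨ZMod.unitOfCoprime d hd.2, Finset.mem_univ _, by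
      rw [ZMod.coe_unitOfCoprime, ZMod.val_natCast_of_lt hd.1]⟩
  · intro u _
    rw [ZMod.natCast_zmod_val, ZMod.inv_coe_unit]
    have h := ZMod.stdAddChar_coe (N := c)
      (m * ((u : ZMod c).val : ℤ) + n * (((u⁻¹ : (ZMod c)ˣ) : ZMod c).val : ℤ))
    rw [← mul_div_assoc, ← h]
    push_cast
    rw [ZMod.natCast_zmod_val, ZMod.natCast_zmod_val]

/-- The Weil bound for Kloosterman sums:
`|S(m, n, c)| ≤ τ(c) · gcd(m, n, c)^{1/2} · c^{1/2}`. -/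
theorem weil_bound_kloosterman (m n : ℤ) (c : ℕ) (hc : 0 < c) :
    ‖kloostermanSum m n c‖ ≤
      (c.divisors.card : ℝ) * Real.sqrt (Int.gcd m (Int.gcd n (c : ℤ))) * Real.sqrt c := by
  have : NeZero c := ⟨hc.ne'⟩
  rw [kloostermanSum_eq_kloostermanUnits]
  exact norm_kloostermanUnits_le c m n
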